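/- arXiv:2502.08738 — 3 statements merged into one kernel-verified Lean document; each statement's English description precedes it below -/
import Mathlib

section
/- (Key Polynomial Stability) For all compositions α and β, setting the variable x_{ℓ(α)+1} to 0 in the key polynomial K_{α*0*β}(x_1,…,x_{ℓ(α)+ℓ(β)+1}) yields K_{α*β}(x_1,…,x_{ℓ(α)}, x_{ℓ(α)+2},…,x_{ℓ(α)+ℓ(β)+1}). -/
open MvPolynomial

/-- Key polynomials, in infinitely many variables `x_1, x_2, …` (indexed by `ℕ`),
indexed by compositions `γ : ℕ →₀ ℕ`, defined recursively: `K_γ = x^γ` when `γ` is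
weakly decreasing, and `K_{s_i(γ)} = ξ_i(K_γ)` whenever `γ_i > γ_{i+1}`, where `ξ_i`
is encoded by its defining relation
`(x_i − x_{i+1})·ξ_i(f) = x_i·f − x_{i+1}·s_i(f)`. -/
inductive IsKey : (ℕ →₀ ℕ) → MvPolynomial ℕ ℤ → Prop
  | base (γ : ℕ →₀ ℕ) (hγ : ∀ i j : ℕ, i ≤ j → γ j ≤ γ i) :
      IsKey γ (monomial γ 1)
  | step (γ : ℕ →₀ ℕ) (i : ℕ) (h : γ (i + 1) < γ i)
      (f g : MvPolynomial ℕ ℤ) (hf : IsKey γ f)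
      (hg : (X i - X (i + 1)) * g =
        X i * f - X (i + 1) * rename (Equiv.swap i (i + 1)) f) :
      IsKey (Finsupp.equivMapDomain (Equiv.swap i (i + 1)) γ) g

namespace KeyAux

/-- The defining relation of `g = ξ_i f`. -/
def R (i : ℕ) (f g : MvPolynomial ℕ ℤ) : Prop :=
  (X i - X (i + 1)) * g = X i * f - X (i + 1) * rename (Equiv.swap i (i + 1)) f

/-- The simple transposition acting on compositions. -/
noncomputable def S (i : ℕ) (γ : ℕ →₀ ℕ) : ℕ →₀ ℕ :=
  Finsupp.equivMapDomain (Equiv.swap i (i + 1)) γ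

lemma S_apply (i : ℕ) (γ : ℕ →₀ ℕ) (k : ℕ) :
    S i γ k = if k = i then γ (i + 1) else if k = i + 1 then γ i else γ k := by
  simp only [S, Finsupp.equivMapDomain_apply, Equiv.symm_swap, Equiv.swap_apply_def]
  split_ifs <;> rfl

lemma S_S (i : ℕ) (γ : ℕ →₀ ℕ) : S i (S i γ) = γ := by
  ext k
  simp only [S_apply]
  split_ifs <;> simp_all

lemma X_sub_ne {i j : ℕ} (h : i ≠ j) : (X i - X j : MvPolynomial ℕ ℤ) ≠ 0 := by
  rw [sub_ne_zero]
  exact fun e => h (X_injective e)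

lemma exists_R (i : ℕ) (f : MvPolynomial ℕ ℤ) : ∃ g, R i f g := by
  have h : (X i - X (i + 1) : MvPolynomial ℕ ℤ) ∣ f - rename (Equiv.swap i (i + 1)) f := by
    rw [← Ideal.mem_span_singleton, ← Ideal.Quotient.eq]
    have key : (Ideal.Quotient.mkₐ ℤ (Ideal.span {(X i - X (i + 1) : MvPolynomial ℕ ℤ)})) =
        (Ideal.Quotient.mkₐ ℤ (Ideal.span {(X i - X (i + 1) : MvPolynomial ℕ ℤ)})).comp
          (rename (Equiv.swap i (i + 1))) := by
      have e : Ideal.Quotient.mk (Ideal.span {(X i - X (i + 1) : MvPolynomial ℕ ℤ)}) (X i) =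
          Ideal.Quotient.mk (Ideal.span {(X i - X (i + 1) : MvPolynomial ℕ ℤ)}) (X (i + 1)) := by
        rw [Ideal.Quotient.eq]; exact Ideal.mem_span_singleton_self _
      apply MvPolynomial.algHom_ext
      intro k
      simp only [AlgHom.comp_apply, rename_X, Ideal.Quotient.mkₐ_eq_mk, Equiv.swap_apply_def]
      split_ifs with h1 h2
      · rw [h1, e]
      · rw [h2, e]
      · rfl
    exact DFunLike.congr_fun key f
  obtain ⟨q, hq⟩ := h
  refine ⟨f + X (i + 1) * q, ?_⟩
  unfold R
  linear_combination -(X (i + 1)) * hq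

lemma R_unique {i : ℕ} {f g g' : MvPolynomial ℕ ℤ} (h : R i f g) (h' : R i f g') : g = g' :=
  mul_left_cancel₀ (X_sub_ne (Nat.ne_of_lt (Nat.lt_succ_self i))) (h.trans h'.symm)

lemma mk_step {γ : ℕ →₀ ℕ} {i : ℕ} {f g : MvPolynomial ℕ ℤ} (h : γ i < γ (i + 1))
    (hf : IsKey (S i γ) f) (hR : R i f g) : IsKey γ g := by
  have := IsKey.step (S i γ) i (by simpa [S_apply] using h) f g hf hR
  change IsKey (S i (S i γ)) g at this
  rwa [S_S] at this

lemma key_inv {γ : ℕ →₀ ℕ} {f : MvPolynomial ℕ ℤ} (hf : IsKey γ f) :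
    ((∀ i j : ℕ, i ≤ j → γ j ≤ γ i) ∧ f = monomial γ 1) ∨
      ∃ i f1, γ i < γ (i + 1) ∧ IsKey (S i γ) f1 ∧ R i f1 f := by
  cases hf with
  | base _ h => exact Or.inl ⟨h, rfl⟩
  | step γ0 i h f0 _ hf0 hg =>
    refine Or.inr ⟨i, f0, ?_, ?_, hg⟩
    · change S i γ0 i < S i γ0 (i + 1)
      simpa [S_apply] using h
    · change IsKey (S i (S i γ0)) f0
      rwa [S_S]

/-- Termination measure. -/
noncomputable def m (γ : ℕ →₀ ℕ) : ℕ := γ.sum fun k n => k * n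

lemma m_S {γ : ℕ →₀ ℕ} {i : ℕ} (h : γ i < γ (i + 1)) : m (S i γ) < m γ := by
  classical
  set T := (γ.support.erase i).erase (i + 1) with hT
  have e : ∀ δ : ℕ →₀ ℕ, (∀ k, k ≠ i → k ≠ i + 1 → δ k = γ k) →
      m δ = i * δ i + ((i + 1) * δ (i + 1) + ∑ k ∈ T, k * γ k) := by
    intro δ hδ
    unfold m
    rw [Finsupp.sum_of_support_subset (s := insert i (insert (i + 1) T))]
    · rw [Finset.sum_insert (by simp [hT]), Finset.sum_insert (by simp [hT])]
      congr 2
      apply Finset.sum_congr rfl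
      intro k hk
      simp only [hT, Finset.mem_erase] at hk
      rw [hδ k hk.2.1 hk.1]
    · intro k hk
      by_cases h1 : k = i
      · simp [h1]
      by_cases h2 : k = i + 1
      · simp [h2]
      rw [Finsupp.mem_support_iff, hδ k h1 h2] at hk
      simp [hT, h1, h2, hk]
    · simp
  rw [e γ (fun _ _ _ => rfl), e (S i γ) (fun k h1 h2 => by simp [S_apply, h1, h2])]
  simp only [S_apply]
  simp
  nlinarith

lemma key_exists (γ : ℕ →₀ ℕ) : ∃ f, IsKey γ f := by
  induction hn : m γ using Nat.strong_induction_on generalizing γ with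
  | _ n ih =>
    by_cases h : ∀ k, γ (k + 1) ≤ γ k
    · exact ⟨_, IsKey.base γ (fun i j hij => antitone_nat_of_succ_le h hij)⟩
    · push Not at h
      obtain ⟨i, hi⟩ := h
      obtain ⟨f1, hf1⟩ := ih _ (hn ▸ m_S hi) (S i γ) rfl
      obtain ⟨f, hf⟩ := exists_R i f1
      exact ⟨f, mk_step hi hf1 hf⟩

/-- The simple transposition acting on polynomials. -/
noncomputable def s (i : ℕ) : MvPolynomial ℕ ℤ →ₐ[ℤ] MvPolynomial ℕ ℤ :=
  rename (Equiv.swap i (i + 1))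

lemma s_X (i k : ℕ) : s i (X k) = X (if k = i then i + 1 else if k = i + 1 then i else k) := by
  simp [s, Equiv.swap_apply_def]

lemma s_s (i : ℕ) (f : MvPolynomial ℕ ℤ) : s i (s i f) = f := by
  simp only [s, rename_rename]
  have : (Equiv.swap i (i + 1) : ℕ → ℕ) ∘ (Equiv.swap i (i + 1)) = id := by
    ext k; simp
  rw [this, rename_id_apply]

lemma s_comm {i j : ℕ} (h : i + 1 < j) (f : MvPolynomial ℕ ℤ) : s i (s j f) = s j (s i f) := by
  have : (s i).comp (s j) = (s j).comp (s i) := by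
    apply MvPolynomial.algHom_ext
    intro k
    simp only [AlgHom.comp_apply, s_X]
    congr 1
    split_ifs <;> omega
  exact DFunLike.congr_fun this f

lemma s_braid (i : ℕ) (f : MvPolynomial ℕ ℤ) :
    s (i + 1) (s i (s (i + 1) f)) = s i (s (i + 1) (s i f)) := by
  have : (s (i + 1)).comp ((s i).comp (s (i + 1))) = (s i).comp ((s (i + 1)).comp (s i)) := by
    apply MvPolynomial.algHom_ext
    intro k
    simp only [AlgHom.comp_apply, s_X]
    congr 1
    split_ifs <;> omega
  exact DFunLike.congr_fun this f

lemma R_def {i : ℕ} {f g : MvPolynomial ℕ ℤ} :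
    R i f g ↔ (X i - X (i + 1)) * g = X i * f - X (i + 1) * s i f := Iff.rfl

lemma R_comm {i j : ℕ} (h : i + 1 < j) {f u v p q : MvPolynomial ℕ ℤ}
    (hu : R i f u) (hp : R j u p) (hv : R j f v) (hq : R i v q) : p = q := by
  rw [R_def] at *
  have hu' := congrArg (s j) hu
  have hv' := congrArg (s i) hv
  have c := s_comm h f
  simp only [map_sub, map_mul, s_X] at hu' hv'
  simp only [show i ≠ j by omega, show i ≠ j + 1 by omega, show i + 1 ≠ j by omega,
    show i + 1 ≠ j + 1 by omega, show j ≠ i by omega, show j ≠ i + 1 by omega,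
    show j + 1 ≠ i by omega, show j + 1 ≠ i + 1 by omega, if_false] at hu' hv'
  have n1 := X_sub_ne (show i ≠ i + 1 by omega)
  have n2 := X_sub_ne (show j ≠ j + 1 by omega)
  apply mul_left_cancel₀ (mul_ne_zero n1 n2)
  linear_combination (X i - X (i + 1)) * hp - (X j - X (j + 1)) * hq + X j * hu
    - X (j + 1) * hu' - X i * hv + X (i + 1) * hv' - X (i + 1) * X (j + 1) * c

lemma R_braid {i : ℕ} {f u1 u2 u3 v1 v2 v3 : MvPolynomial ℕ ℤ}
    (hu1 : R i f u1) (hu2 : R (i + 1) u1 u2) (hu3 : R i u2 u3)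
    (hv1 : R (i + 1) f v1) (hv2 : R i v1 v2) (hv3 : R (i + 1) v2 v3) : u3 = v3 := by
  rw [R_def] at *
  have c := s_braid i f
  have u1a := congrArg (s (i + 1)) hu1
  have u1b := congrArg (s i) u1a
  have u1c := congrArg (s i) hu1
  have u2a := congrArg (s i) hu2
  have v1a := congrArg (s i) hv1
  have v1b := congrArg (s (i + 1)) v1a
  have v1c := congrArg (s (i + 1)) hv1
  have v2a := congrArg (s (i + 1)) hv2
  simp only [map_sub, map_mul, s_X, s_s] at u1a u1b u1c u2a v1a v1b v1c v2a
  simp only [show i ≠ i + 1 by omega, show i + 1 ≠ i by omega, show i + 1 + 1 ≠ i by omega,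
    show i ≠ i + 1 + 1 by omega, show i + 1 + 1 ≠ i + 1 by omega,
    show i + 1 ≠ i + 1 + 1 by omega, if_false, if_true] at *
  have n1 := X_sub_ne (show i ≠ i + 1 by omega)
  have n2 := X_sub_ne (show i + 1 ≠ i + 1 + 1 by omega)
  have n3 := X_sub_ne (show i ≠ i + 1 + 1 by omega)
  generalize (X i : MvPolynomial ℕ ℤ) = a at *
  generalize (X (i + 1) : MvPolynomial ℕ ℤ) = b at *
  generalize (X (i + 1 + 1) : MvPolynomial ℕ ℤ) = d at *
  generalize s (i + 1) (s i (s (i + 1) f)) = f121 at *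
  generalize s i (s (i + 1) (s i f)) = f212 at *
  generalize s i (s (i + 1) f) = f12 at *
  generalize s (i + 1) (s i f) = f21 at *
  generalize s i f = f1 at *
  generalize s (i + 1) f = f2 at *
  -- `s i u1 = u1`
  have e1 : s i u1 = u1 := by
    apply mul_left_cancel₀ n1
    linear_combination -u1c - hu1
  have e2 : s (i + 1) v1 = v1 := by
    apply mul_left_cancel₀ n2
    linear_combination -v1c - hv1
  rw [e1] at u1c u2a
  rw [e2] at v1c v2a
  generalize s i (s (i + 1) u1) = w1 at *
  generalize s (i + 1) (s i v1) = w2 at *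
  generalize s (i + 1) u1 = w3 at *
  generalize s i v1 = w4 at *
  generalize s i u2 = w5 at *
  generalize s (i + 1) v2 = w6 at *
  apply mul_left_cancel₀ (mul_ne_zero (mul_ne_zero n1 n2) n3)
  have A : (a - b) * (b - d) * (a - d) * u3 =
      a ^ 2 * b * f - a * b ^ 2 * f1 - a ^ 2 * d * f2 + a * d ^ 2 * f21 + b ^ 2 * d * f12
        - b * d ^ 2 * f212 := by
    linear_combination (b - d) * (a - d) * hu3 + a * (a - d) * hu2 - b * (b - d) * u2a + a * b * hu1
      - a * d * u1a + b * d * u1b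
  have B : (a - b) * (b - d) * (a - d) * v3 =
      a ^ 2 * b * f - a * b ^ 2 * f1 - a ^ 2 * d * f2 + a * d ^ 2 * f21 + b ^ 2 * d * f12
        - b * d ^ 2 * f121 := by
    linear_combination (a - b) * (a - d) * hv3 + b * (a - d) * hv2 - d * (a - b) * v2a + a ^ 2 * hv1
      - b ^ 2 * v1a + d ^ 2 * v1b
  rw [A, B, c]

lemma key_unique {γ : ℕ →₀ ℕ} {f g : MvPolynomial ℕ ℤ} (hf : IsKey γ f) (hg : IsKey γ g) :
    f = g := by
  induction hn : m γ using Nat.strong_induction_on generalizing γ f g with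
  | _ n ih =>
    rcases key_inv hf with ⟨hd, rfl⟩ | ⟨i, f1, hi, hf1, hRf⟩
    · rcases key_inv hg with ⟨-, rfl⟩ | ⟨j, g1, hj, -, -⟩
      · rfl
      · exact absurd (hd j (j + 1) (by omega)) (by omega)
    rcases key_inv hg with ⟨hd, rfl⟩ | ⟨j, g1, hj, hg1, hRg⟩
    · exact absurd (hd i (i + 1) (by omega)) (by omega)
    have ihi : ∀ {p q}, IsKey (S i γ) p → IsKey (S i γ) q → p = q :=
      fun hp hq => ih _ (hn ▸ m_S hi) hp hq rfl
    have ihj : ∀ {p q}, IsKey (S j γ) p → IsKey (S j γ) q → p = q :=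
      fun hp hq => ih _ (hn ▸ m_S hj) hp hq rfl
    clear ih
    wlog hij : i ≤ j generalizing i j f g f1 g1
    · exact (this hg hf j g1 hj hg1 hRg i f1 hi hf1 hRf ihj ihi (by omega)).symm
    rcases Nat.lt_or_ge (i + 1) j with h | h
    · -- commuting
      have hS : S j (S i γ) = S i (S j γ) := by
        ext k
        simp only [S_apply]
        split_ifs <;> first | rfl | omega
      obtain ⟨h0, hh0⟩ := key_exists (S j (S i γ))
      obtain ⟨u, hu⟩ := exists_R j h0
      obtain ⟨v, hv⟩ := exists_R i h0
      have ku : IsKey (S i γ) u := mk_step (by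
        simp only [S_apply]; split_ifs <;> first | omega | assumption) hh0 hu
      have kv : IsKey (S j γ) v := mk_step (by
        simp only [S_apply]; split_ifs <;> first | omega | assumption) (hS ▸ hh0) hv
      rw [ihi hf1 ku] at hRf
      rw [ihj hg1 kv] at hRg
      exact (R_comm h hv hRg hu hRf).symm
    · rcases Nat.eq_or_lt_of_le hij with rfl | hlt
      · rw [ihi hf1 hg1] at hRf
        exact R_unique hRf hRg
      obtain rfl : j = i + 1 := by omega
      have hS : S i (S (i + 1) (S i γ)) = S (i + 1) (S i (S (i + 1) γ)) := by
        ext k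
        simp only [S_apply]
        split_ifs <;> first | rfl | omega
      obtain ⟨h0, hh0⟩ := key_exists (S i (S (i + 1) (S i γ)))
      obtain ⟨u, hu⟩ := exists_R i h0
      obtain ⟨u', hu'⟩ := exists_R (i + 1) u
      obtain ⟨v, hv⟩ := exists_R (i + 1) h0
      obtain ⟨v', hv'⟩ := exists_R i v
      have ku : IsKey (S (i + 1) (S i γ)) u := mk_step (by
        simp only [S_apply]; split_ifs <;> omega) hh0 hu
      have ku' : IsKey (S i γ) u' := mk_step (by
        simp only [S_apply]; split_ifs <;> omega) ku hu'
      have kv : IsKey (S i (S (i + 1) γ)) v := mk_step (by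
        simp only [S_apply]; split_ifs <;> omega) (hS ▸ hh0) hv
      have kv' : IsKey (S (i + 1) γ) v' := mk_step (by
        simp only [S_apply]; split_ifs <;> omega) kv hv'
      rw [ihi hf1 ku'] at hRf
      rw [ihj hg1 kv'] at hRg
      exact R_braid hu hu' hRf hv hv' hRg

/-- Setting the variable `x_a` to zero. -/
noncomputable def ev (a : ℕ) : MvPolynomial ℕ ℤ →ₐ[ℤ] MvPolynomial ℕ ℤ :=
  aeval (fun k : ℕ => if k = a then 0 else X k : ℕ → MvPolynomial ℕ ℤ)

/-- Shifting the variables from `x_a` on. -/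
noncomputable def ren (a : ℕ) : MvPolynomial ℕ ℤ →ₐ[ℤ] MvPolynomial ℕ ℤ :=
  rename (fun k : ℕ => if k < a then k else k + 1)

lemma ev_X (a k : ℕ) : ev a (X k) = if k = a then 0 else X k := by simp [ev]

lemma ren_X (a k : ℕ) : ren a (X k) = X (if k < a then k else k + 1) := by simp [ren]

lemma ev_s {a i : ℕ} (h1 : i ≠ a) (h2 : i + 1 ≠ a) (f : MvPolynomial ℕ ℤ) :
    ev a (s i f) = s i (ev a f) := by
  have : (ev a).comp (s i) = (s i).comp (ev a) := by
    apply MvPolynomial.algHom_ext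
    intro k
    simp only [AlgHom.comp_apply, s_X, ev_X]
    split_ifs <;> first | omega | simp_all [s_X]
  exact DFunLike.congr_fun this f

lemma ev_s_self (a : ℕ) (f : MvPolynomial ℕ ℤ) :
    ev a (s a f) = s a (ev (a + 1) f) := by
  have : (ev a).comp (s a) = (s a).comp (ev (a + 1)) := by
    apply MvPolynomial.algHom_ext
    intro k
    simp only [AlgHom.comp_apply, s_X, ev_X]
    split_ifs <;> first | omega | simp_all [s_X]
  exact DFunLike.congr_fun this f

lemma ren_s_lt {a i : ℕ} (h : i + 1 < a) (f : MvPolynomial ℕ ℤ) :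
    ren a (s i f) = s i (ren a f) := by
  have : (ren a).comp (s i) = (s i).comp (ren a) := by
    apply MvPolynomial.algHom_ext
    intro k
    simp only [AlgHom.comp_apply, s_X, ren_X]
    congr 1
    split_ifs <;> omega
  exact DFunLike.congr_fun this f

lemma ren_s_ge {a i : ℕ} (h : a ≤ i) (f : MvPolynomial ℕ ℤ) :
    ren a (s i f) = s (i + 1) (ren a f) := by
  have : (ren a).comp (s i) = (s (i + 1)).comp (ren a) := by
    apply MvPolynomial.algHom_ext
    intro k
    simp only [AlgHom.comp_apply, s_X, ren_X]
    congr 1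
    split_ifs <;> omega
  exact DFunLike.congr_fun this f

lemma s_ren_succ (a : ℕ) (f : MvPolynomial ℕ ℤ) : s a (ren (a + 1) f) = ren a f := by
  have : (s a).comp (ren (a + 1)) = ren a := by
    apply MvPolynomial.algHom_ext
    intro k
    simp only [AlgHom.comp_apply, s_X, ren_X]
    congr 1
    split_ifs <;> omega
  exact DFunLike.congr_fun this f

lemma main {γ' : ℕ →₀ ℕ} {f : MvPolynomial ℕ ℤ} (hf : IsKey γ' f) :
    ∀ (a : ℕ) (γ : ℕ →₀ ℕ),
      (∀ j, γ' j = if j < a then γ j else if j = a then 0 else γ (j - 1)) →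
      ∃ g, IsKey γ g ∧ ev a f = ren a g := by
  induction hf with
  | base γ' hd =>
    intro a γ hins
    have ha : γ' a = 0 := by simp [hins]
    have hz : ∀ j, a ≤ j → γ' j = 0 := fun j hj => by have := hd a j hj; omega
    have hγ : γ = γ' := by
      ext j
      by_cases h : j < a
      · simp [hins, h]
      · have h1 := hins (j + 1)
        rw [hz (j + 1) (by omega), if_neg (by omega), if_neg (by omega)] at h1
        rw [hz j (by omega)]
        simpa using h1.symm
    subst hγ
    refine ⟨_, IsKey.base γ hd, ?_⟩
    rw [monomial_eq]
    simp only [map_one, one_mul, Finsupp.prod, map_prod, map_pow, ev_X, ren_X]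
    apply Finset.prod_congr rfl
    intro k hk
    have : k < a := by
      by_contra hc
      exact (Finsupp.mem_support_iff.1 hk) (hz k (by omega))
    rw [if_neg (by omega), if_pos this]
  | step γ0 i h f0 f hf0 hR ih =>
    intro a γ hins
    change ∀ j, S i γ0 j = _ at hins
    change R i f0 f at hR
    rw [R_def] at hR
    have hR' := congrArg (ev a) hR
    simp only [map_sub, map_mul, ev_X] at hR'
    have hi0 := hins i
    have hi1 := hins (i + 1)
    simp only [S_apply, if_true, show i + 1 ≠ i by omega, if_false] at hi0 hi1
    rcases lt_trichotomy i a with hia | rfl | hia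
    · by_cases hia' : i + 1 = a
      · rw [if_neg (by omega), if_pos hia'] at hi1
        omega
      have hlt : i + 1 < a := by omega
      rw [if_pos hia] at hi0
      rw [if_pos hlt] at hi1
      obtain ⟨g1, kg1, e1⟩ := ih a (S i γ) (by
        intro j
        have := hins j
        simp only [S_apply] at this ⊢
        by_cases j1 : j = i
        · subst j1; simp [hia, hi1]
        by_cases j2 : j = i + 1
        · subst j2; simp [hlt, hi0]
        simp only [j1, j2, if_false] at this ⊢
        rw [this]
        split_ifs <;> first | rfl | omega)
      obtain ⟨g, hg⟩ := exists_R i g1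
      refine ⟨g, mk_step (by omega) kg1 hg, ?_⟩
      have hg' := congrArg (ren a) (R_def.1 hg)
      simp only [map_sub, map_mul, ren_X, if_pos hia, if_pos hlt] at hg'
      rw [if_neg (by omega), if_neg hia', ev_s (by omega) hia', e1] at hR'
      rw [ren_s_lt hlt] at hg'
      exact mul_left_cancel₀ (X_sub_ne (show i ≠ i + 1 by omega)) (hR'.trans hg'.symm)
    · obtain ⟨g1, kg1, e1⟩ := ih (i + 1) γ (by
        intro j
        have := hins j
        simp only [S_apply] at this
        by_cases j1 : j = i
        · subst j1; simpa using hi1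
        by_cases j2 : j = i + 1
        · subst j2; simpa using hi0
        simp only [j1, j2, if_false] at this ⊢
        rw [this]
        split_ifs <;> first | rfl | omega)
      refine ⟨g1, kg1, ?_⟩
      simp only [if_true, show i + 1 ≠ i by omega, if_false, ev_s_self, e1, s_ren_succ] at hR'
      apply mul_left_cancel₀ (X_ne_zero (R := ℤ) (i + 1))
      linear_combination -hR'
    · obtain ⟨i, rfl⟩ : ∃ k, i = k + 1 := ⟨i - 1, by omega⟩
      rw [if_neg (by omega), if_neg (by omega)] at hi0 hi1
      simp only [Nat.add_sub_cancel] at hi0 hi1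
      obtain ⟨g1, kg1, e1⟩ := ih a (S i γ) (by
        intro j
        have := hins j
        simp only [S_apply] at this ⊢
        by_cases j1 : j = i + 1
        · subst j1
          rw [if_neg (by omega), if_neg (by omega)]; simp [hi1]
        by_cases j2 : j = i + 1 + 1
        · subst j2
          rw [if_neg (by omega), if_neg (by omega)]; simp [hi0]
        simp only [j1, j2, if_false] at this
        rw [this]
        split_ifs <;> first | rfl | omega)
      obtain ⟨g, hg⟩ := exists_R i g1
      refine ⟨g, mk_step (by omega) kg1 hg, ?_⟩
      have hg' := congrArg (ren a) (R_def.1 hg)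
      simp only [map_sub, map_mul, ren_X] at hg'
      rw [if_neg (by omega), if_neg (by omega), ren_s_ge (by omega)] at hg'
      rw [if_neg (by omega), if_neg (by omega), ev_s (by omega) (by omega), e1] at hR'
      exact mul_left_cancel₀ (X_sub_ne (show i + 1 ≠ i + 1 + 1 by omega)) (hR'.trans hg'.symm)

end KeyAux

/-- Key Polynomial Stability: For all compositions `α` (of length `a`)
and `β` (of length `b`), setting the variable `x_{a+1}` to `0` in
`K_{α*0*β}(x_1,…,x_{a+b+1})` yields `K_{α*β}(x_1,…,x_a, x_{a+2},…,x_{a+b+1})`.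
Variables are `0`-indexed by `ℕ`; `γ` encodes the concatenation `α*β` (supported on
the first `a+b` indices) and `γ'` encodes `α*0*β`, i.e. `γ` with a `0` inserted at
position `a`.  The right-hand side is `K_{α*β}` with variables renamed along
`k ↦ k` for `k < a` and `k ↦ k+1` for `k ≥ a`. -/
theorem key_polynomial_stability
    (a b : ℕ) (γ γ' : ℕ →₀ ℕ)
    (hsupp : ∀ j, a + b ≤ j → γ j = 0)
    (hins : ∀ j, γ' j = if j < a then γ j else if j = a then 0 else γ (j - 1))
    (f g : MvPolynomial ℕ ℤ)
    (hf : IsKey γ' f) (hg : IsKey γ g) :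
    aeval (fun k : ℕ => if k = a then 0 else X k : ℕ → MvPolynomial ℕ ℤ) f =
      rename (fun k : ℕ => if k < a then k else k + 1) g := by
  obtain ⟨g0, hg0, e⟩ := KeyAux.main hf a γ hins
  rw [KeyAux.key_unique hg hg0]
  exact e
end

section
/- For a partition λ with at most n parts, the key polynomial indexed by the reversed (weakly increasing) partition, K_{rev(λ)}(x_1,…,x_n), equals the Schur polynomial s_λ(x_1,…,x_n). -/
open MvPolynomial

/-- The complete homogeneous symmetric polynomial `h_k` in `n` variables, extended
by `0` to negative integer indices. -/
noncomputable def hInt (n : ℕ) (k : ℤ) : MvPolynomial (Fin n) ℤ :=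
  if 0 ≤ k then MvPolynomial.hsymm (Fin n) ℤ k.toNat else 0

/-- The Schur polynomial `s_λ` in `n` variables, for a partition `λ` with `k`
parts, via the Jacobi–Trudi determinant `s_λ = det(h_{λ_i − i + j})_{1 ≤ i,j ≤ k}`. -/
noncomputable def schurJT (n k : ℕ) (lam : Fin k → ℕ) : MvPolynomial (Fin n) ℤ :=
  Matrix.det (Matrix.of fun i j : Fin k => hInt n ((lam i : ℤ) + (j : ℤ) - (i : ℤ)))


/-! ### Part 1: Jacobi–Trudi versus bialternant -/

lemma kp_hsymm_eq_coeff (n m : ℕ) :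
    hsymm (Fin n) ℤ m =
      PowerSeries.coeff m (∏ l : Fin n,
        (PowerSeries.mk (fun d => (X l : MvPolynomial (Fin n) ℤ) ^ d))) := by
  rw [PowerSeries.coeff_prod, hsymm]
  refine Finset.sum_bij (fun s _ => Multiset.toFinsupp (s : Multiset (Fin n))) ?_ ?_ ?_ ?_
  · intro s _
    rw [Finset.mem_finsuppAntidiag]
    refine ⟨?_, Finset.subset_univ _⟩
    change ∑ i : Fin n, Multiset.count i (s : Multiset (Fin n)) = m
    rw [Multiset.sum_count_eq_card (by simp)]
    exact s.2
  · intro a _ b _ h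
    exact Subtype.ext (Multiset.toFinsupp.injective h)
  · intro b hb
    rw [Finset.mem_finsuppAntidiag] at hb
    refine ⟨⟨Finsupp.toMultiset b, ?_⟩, Finset.mem_univ _, ?_⟩
    · rw [Finsupp.card_toMultiset, Finsupp.sum_fintype _ _ (by simp)]
      exact hb.1
    · simp
  · intro s _
    simp only [PowerSeries.coeff_mk, Multiset.toFinsupp_apply]
    rw [Finset.prod_multiset_map_count]
    refine Finset.prod_subset (Finset.subset_univ _) ?_
    intro x _ hx
    rw [Multiset.count_eq_zero_of_notMem (by simpa using hx), pow_zero]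

lemma kp_geom {R : Type*} [CommRing R] (a : R) :
    PowerSeries.mk (fun d => a ^ d) * (1 - PowerSeries.C a * PowerSeries.X) = 1 := by
  ext d
  rw [mul_sub, mul_one, ← mul_assoc]
  cases d with
  | zero => simp
  | succ d =>
    rw [map_sub, PowerSeries.coeff_succ_mul_X, mul_comm _ (PowerSeries.C a),
      PowerSeries.coeff_C_mul]
    simp [PowerSeries.coeff_one, pow_succ']

/-- the polynomial `∏_{l ≠ k} (1 - x_l t)` -/
noncomputable def kpP (n : ℕ) (k : Fin n) : Polynomial (MvPolynomial (Fin n) ℤ) :=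
  ∏ l ∈ Finset.univ.erase k, (1 - Polynomial.C (X l) * Polynomial.X)

lemma kp_P_coeff (n : ℕ) (k : Fin n) (d : ℕ) (hd : n ≤ d) : (kpP n k).coeff d = 0 := by
  apply Polynomial.coeff_eq_zero_of_natDegree_lt
  have h1 : (kpP n k).natDegree ≤ ∑ l ∈ Finset.univ.erase k, 1 := by
    refine (Polynomial.natDegree_prod_le _ _).trans (Finset.sum_le_sum ?_)
    intro l _
    compute_degree
  have hk := k.2
  simp at h1
  omega

lemma kp_pow_eq (n : ℕ) (k : Fin n) (a : ℕ) :
    (X k : MvPolynomial (Fin n) ℤ) ^ a =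
      ∑ j : Fin n, hInt n ((a : ℤ) - (n - 1) + j) * (kpP n k).coeff (n - 1 - j) := by
  have h1 : (∏ l : Fin n, (PowerSeries.mk (fun d => (X l : MvPolynomial (Fin n) ℤ) ^ d)))
      * (kpP n k : PowerSeries (MvPolynomial (Fin n) ℤ))
      = PowerSeries.mk (fun d => (X k : MvPolynomial (Fin n) ℤ) ^ d) := by
    have : (kpP n k : PowerSeries (MvPolynomial (Fin n) ℤ)) =
        ∏ l ∈ Finset.univ.erase k, (1 - PowerSeries.C (X l) * PowerSeries.X) := by
      rw [kpP, ← Polynomial.coeToPowerSeries.ringHom_apply, map_prod]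
      simp
    rw [this, ← Finset.mul_prod_erase _ _ (Finset.mem_univ k), mul_assoc,
      ← Finset.prod_mul_distrib]
    simp [kp_geom]
  have h2 := congrArg (PowerSeries.coeff a) h1
  rw [PowerSeries.coeff_mul, PowerSeries.coeff_mk] at h2
  rw [← h2]
  simp only [← kp_hsymm_eq_coeff, Polynomial.coeff_coe]
  rw [Finset.Nat.sum_antidiagonal_eq_sum_range_succ_mk,
    ← Finset.sum_range_reflect]
  have e1 : ∑ j : Fin n, hInt n ((a : ℤ) - (n - 1) + j) * (kpP n k).coeff (n - 1 - j)
      = ∑ d ∈ Finset.range n, hInt n ((a : ℤ) - d) * (kpP n k).coeff d := by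
    rw [← Finset.sum_range_reflect, ← Fin.sum_univ_eq_sum_range
      (fun j => hInt n ((a : ℤ) - ((n - 1 - j : ℕ) : ℤ)) * (kpP n k).coeff (n - 1 - j))]
    refine Finset.sum_congr rfl fun j _ => ?_
    have hj := j.2
    congr 2
    omega
  rw [e1]
  have e2 : ∑ d ∈ Finset.range n, hInt n ((a : ℤ) - d) * (kpP n k).coeff d
      = ∑ d ∈ Finset.range (n + (a + 1)), hInt n ((a : ℤ) - d) * (kpP n k).coeff d := by
    refine Finset.sum_subset (by intro x; simp; omega) ?_
    intro d _ hd
    rw [kp_P_coeff n k d (by simpa using hd), mul_zero]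
  have e3 : ∑ d ∈ Finset.range (a + 1), hInt n ((a : ℤ) - d) * (kpP n k).coeff d
      = ∑ d ∈ Finset.range (n + (a + 1)), hInt n ((a : ℤ) - d) * (kpP n k).coeff d := by
    refine Finset.sum_subset (by intro x; simp; omega) ?_
    intro d _ hd
    have hd : a + 1 ≤ d := by simpa using hd
    rw [hInt, if_neg (by omega), zero_mul]
  rw [e2, ← e3]
  refine Finset.sum_congr rfl fun d hd => ?_
  have hd : d < a + 1 := by simpa using hd
  have q1 : a.succ - 1 - d = a - d := by omega
  have q2 : a - (a + 1 - 1 - d) = d := by omega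
  rw [hInt, if_pos (by omega)]
  simp only [Nat.succ_eq_add_one] at *
  rw [q2, q1]
  congr 2
  omega

/-- the alternant matrix -/
noncomputable def kpV (n : ℕ) (lam : Fin n → ℕ) : Matrix (Fin n) (Fin n) (MvPolynomial (Fin n) ℤ) :=
  Matrix.of fun i k => X k ^ (lam i + (n - 1 - i))

lemma kp_V_eq (n : ℕ) (lam : Fin n → ℕ) :
    (kpV n lam).det = schurJT n n lam *
      (Matrix.of fun j k : Fin n => (kpP n k).coeff (n - 1 - j)).det := by
  rw [schurJT, ← Matrix.det_mul]
  congr 1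
  ext1 i k
  rw [kpV, Matrix.mul_apply, Matrix.of_apply, kp_pow_eq]
  refine Finset.sum_congr rfl fun j _ => ?_
  simp only [Matrix.of_apply]
  have hi := i.2
  congr 2
  omega

lemma kp_schur_zero (n : ℕ) : schurJT n n (fun _ => 0) = 1 := by
  rw [schurJT, Matrix.det_of_isUpperTriangular]
  · simp [hInt]
  · intro i j hij
    have : (j : ℕ) < i := hij
    simp only [Matrix.of_apply, hInt]
    rw [if_neg (by omega)]

lemma kp_bialternant (n : ℕ) (lam : Fin n → ℕ) :
    (kpV n lam).det = schurJT n n lam * (kpV n (fun _ => 0)).det := by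
  rw [kp_V_eq n lam, kp_V_eq n (fun _ => 0), kp_schur_zero, one_mul]

lemma kp_V_ne (n : ℕ) : (kpV n (fun _ => 0)).det ≠ 0 := by
  have h : kpV n (fun _ => 0) =
      (Matrix.vandermonde (fun k : Fin n => (X k : MvPolynomial (Fin n) ℤ))).transpose.submatrix
        (Fin.revPerm) id := by
    ext1 i k
    simp only [kpV, Matrix.of_apply, Matrix.submatrix_apply, Matrix.transpose_apply,
      Matrix.vandermonde_apply, Fin.revPerm_apply, Fin.val_rev, id]
    congr 1
    omega
  rw [h, Matrix.det_permute, Matrix.det_transpose]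
  refine mul_ne_zero ?_ (Matrix.det_vandermonde_ne_zero_iff.2 (X_injective))
  rcases Int.units_eq_one_or (Equiv.Perm.sign (Fin.revPerm : Equiv.Perm (Fin n))) with h | h <;>
    simp [h]

/-! ### Part 2: isobaric divided differences and symmetry of key polynomials -/

/-- The defining relation of the isobaric divided difference. -/
def kpRel (i : ℕ) (f g : MvPolynomial ℕ ℤ) : Prop :=
  (X i - X (i + 1)) * g = X i * f - X (i + 1) * rename (Equiv.swap i (i + 1)) f

lemma kp_X_ne {i j : ℕ} (h : i ≠ j) : (X i - X j : MvPolynomial ℕ ℤ) ≠ 0 :=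
  sub_ne_zero.2 fun h' => h (X_injective h')

lemma kp_dvd (i : ℕ) (f : MvPolynomial ℕ ℤ) :
    (X i - X (i + 1) : MvPolynomial ℕ ℤ) ∣ f - rename (Equiv.swap i (i + 1)) f := by
  induction f using MvPolynomial.induction_on with
  | C a => simp
  | add p q hp hq =>
    rw [map_add, add_sub_add_comm]
    exact dvd_add hp hq
  | mul_X p k hp =>
    have h2 : (X i - X (i + 1) : MvPolynomial ℕ ℤ) ∣ X k - X (Equiv.swap i (i + 1) k) := by
      rw [Equiv.swap_apply_def]
      split_ifs with h1 h2
      · rw [h1]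
      · rw [h2, ← neg_sub, neg_dvd]
      · simp
    rw [map_mul, rename_X]
    have : p * X k - rename (Equiv.swap i (i + 1)) p * X (Equiv.swap i (i + 1) k)
      = (p - rename (Equiv.swap i (i + 1)) p) * X k
        + rename (Equiv.swap i (i + 1)) p * (X k - X (Equiv.swap i (i + 1) k)) := by ring
    rw [this]
    exact dvd_add (hp.mul_right _) (h2.mul_left _)

lemma kp_exists (i : ℕ) (f : MvPolynomial ℕ ℤ) : ∃ g, kpRel i f g := by
  obtain ⟨q, hq⟩ := kp_dvd i f
  refine ⟨f + X (i + 1) * q, ?_⟩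
  unfold kpRel
  linear_combination (-X (i + 1)) * hq

lemma kp_unique {i : ℕ} {f g g' : MvPolynomial ℕ ℤ} (h : kpRel i f g) (h' : kpRel i f g') :
    g = g' := by
  unfold kpRel at h h'
  exact mul_left_cancel₀ (kp_X_ne (by omega)) (h.trans h'.symm)

/-- The isobaric divided difference operator. -/
noncomputable def kpXi (i : ℕ) (f : MvPolynomial ℕ ℤ) : MvPolynomial ℕ ℤ := (kp_exists i f).choose

lemma kp_spec (i : ℕ) (f : MvPolynomial ℕ ℤ) : kpRel i f (kpXi i f) := (kp_exists i f).choose_spec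

lemma kp_xi_eq {i : ℕ} {f g : MvPolynomial ℕ ℤ} (h : kpRel i f g) : g = kpXi i f :=
  kp_unique h (kp_spec i f)

/-- The simple transposition acting on polynomials. -/
noncomputable def kpS (i : ℕ) : MvPolynomial ℕ ℤ →+* MvPolynomial ℕ ℤ :=
  (rename (Equiv.swap i (i + 1)) : MvPolynomial ℕ ℤ →ₐ[ℤ] MvPolynomial ℕ ℤ).toRingHom

lemma kpS_def (i : ℕ) (f : MvPolynomial ℕ ℤ) : kpS i f = rename (Equiv.swap i (i + 1)) f := rfl

lemma kp_spec' (i : ℕ) (f : MvPolynomial ℕ ℤ) :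
    (X i - X (i + 1)) * kpXi i f = X i * f - X (i + 1) * kpS i f := kp_spec i f

lemma kpS_X_left (i : ℕ) : kpS i (X i) = X (i + 1) := by simp [kpS_def]
lemma kpS_X_right (i : ℕ) : kpS i (X (i + 1)) = X i := by simp [kpS_def]
lemma kpS_X_other (i k : ℕ) (h1 : k ≠ i) (h2 : k ≠ i + 1) : kpS i (X k) = X k := by
  simp [kpS_def, Equiv.swap_apply_of_ne_of_ne h1 h2]

lemma kpS_S (i : ℕ) (f : MvPolynomial ℕ ℤ) : kpS i (kpS i f) = f := by
  rw [kpS_def, kpS_def, rename_rename]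
  have : (⇑(Equiv.swap i (i + 1)) ∘ ⇑(Equiv.swap i (i + 1))) = id := by
    ext x; simp
  rw [this, rename_id_apply]

lemma kpS_braid (i : ℕ) (f : MvPolynomial ℕ ℤ) :
    kpS i (kpS (i + 1) (kpS i f)) = kpS (i + 1) (kpS i (kpS (i + 1) f)) := by
  simp only [kpS_def, rename_rename]
  congr 2
  ext x
  simp only [Function.comp, Equiv.swap_apply_def]
  grind

lemma kpS_comm (i j : ℕ) (h : i + 1 < j ∨ j + 1 < i) (f : MvPolynomial ℕ ℤ) :
    kpS i (kpS j f) = kpS j (kpS i f) := by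
  simp only [kpS_def, rename_rename]
  congr 2
  ext x
  simp only [Function.comp, Equiv.swap_apply_def]
  grind

lemma kp_xi_sym (i : ℕ) (f : MvPolynomial ℕ ℤ) : kpS i (kpXi i f) = kpXi i f := by
  have h := kp_spec' i f
  have h' := congrArg (kpS i) h
  simp only [map_sub, map_mul, kpS_X_left, kpS_X_right, kpS_S] at h'
  apply mul_left_cancel₀ (kp_X_ne (show i ≠ i + 1 by omega))
  linear_combination -h - h'

lemma kp_xi_of_sym (i : ℕ) (f : MvPolynomial ℕ ℤ) (h : kpS i f = f) : kpXi i f = f := by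
  symm
  apply kp_xi_eq
  rw [kpRel, ← kpS_def, h]
  ring

lemma kp_xi_comm (i j : ℕ) (h : i + 1 < j ∨ j + 1 < i) (f : MvPolynomial ℕ ℤ) :
    kpXi i (kpXi j f) = kpXi j (kpXi i f) := by
  have e1 := kp_spec' i (kpXi j f)
  have e2 := kp_spec' j f
  have e3 := congrArg (kpS i) e2
  have e1' := kp_spec' j (kpXi i f)
  have e2' := kp_spec' i f
  have e3' := congrArg (kpS j) e2'
  simp only [map_sub, map_mul] at e3 e3'
  rw [kpS_X_other i j (by omega) (by omega), kpS_X_other i (j + 1) (by omega) (by omega)] at e3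
  rw [kpS_X_other j i (by omega) (by omega), kpS_X_other j (i + 1) (by omega) (by omega)] at e3'
  rw [← kpS_comm i j h] at e3'
  apply mul_left_cancel₀ (kp_X_ne (show i ≠ i + 1 by omega))
  apply mul_left_cancel₀ (kp_X_ne (show j ≠ j + 1 by omega))
  linear_combination (X j - X (j + 1)) * e1 + X i * e2 - X (i + 1) * e3
    - ((X i - X (i + 1)) * e1' + X j * e2' - X (j + 1) * e3')

lemma kp_xi_braid1 (i : ℕ) (f : MvPolynomial ℕ ℤ) :
    kpXi i (kpXi (i + 1) (kpXi i f)) = kpXi (i + 1) (kpXi i (kpXi (i + 1) f)) := by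
  have sx := kpS_X_left i
  have sy := kpS_X_right i
  have sz := kpS_X_other i (i + 1 + 1) (by omega) (by omega)
  have tx := kpS_X_other (i + 1) i (by omega) (by omega)
  have ty := kpS_X_left (i + 1)
  have tz := kpS_X_right (i + 1)
  have b := kpS_braid i f
  have hg := kp_spec' i f
  have gs := kp_xi_sym i f
  have hh := kp_spec' (i + 1) (kpXi i f)
  have hk := kp_spec' i (kpXi (i + 1) (kpXi i f))
  have shh := congrArg (kpS i) hh
  have thg := congrArg (kpS (i + 1)) hg
  have sthg := congrArg (kpS i) thg
  have hg' := kp_spec' (i + 1) f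
  have gs' := kp_xi_sym (i + 1) f
  have hh' := kp_spec' i (kpXi (i + 1) f)
  have hk' := kp_spec' (i + 1) (kpXi i (kpXi (i + 1) f))
  have thh' := congrArg (kpS (i + 1)) hh'
  have shg' := congrArg (kpS i) hg'
  have tshg' := congrArg (kpS (i + 1)) shg'
  simp only [map_sub, map_mul, sx, sy, sz, tx, ty, tz, gs, gs', b] at *
  apply mul_left_cancel₀ (kp_X_ne (show i ≠ i + 1 by omega))
  apply mul_left_cancel₀ (kp_X_ne (show i ≠ i + 1 + 1 by omega))
  apply mul_left_cancel₀ (kp_X_ne (show i + 1 ≠ i + 1 + 1 by omega))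
  generalize (X i : MvPolynomial ℕ ℤ) = x at *
  generalize (X (i + 1) : MvPolynomial ℕ ℤ) = y at *
  generalize (X (i + 1 + 1) : MvPolynomial ℕ ℤ) = z at *
  linear_combination (x - z) * (y - z) * hk + x * (x - z) * hh - y * (y - z) * shh
    + x * y * hg - x * z * thg + y * z * sthg
    - ((x - y) * (x - z) * hk' + y * (x - z) * hh' - z * (x - y) * thh'
      + x ^ 2 * hg' - y ^ 2 * shg' + z ^ 2 * tshg')

lemma kp_xi_braid (i j : ℕ) (h : j = i + 1 ∨ i = j + 1) (f : MvPolynomial ℕ ℤ) :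
    kpXi i (kpXi j (kpXi i f)) = kpXi j (kpXi i (kpXi j f)) := by
  rcases h with rfl | rfl
  · exact kp_xi_braid1 i f
  · exact (kp_xi_braid1 j f).symm

/-- The simple transposition acting on compositions. -/
noncomputable def kpSw (i : ℕ) (γ : ℕ →₀ ℕ) : ℕ →₀ ℕ :=
  Finsupp.equivMapDomain (Equiv.swap i (i + 1)) γ

lemma kpSw_apply (i : ℕ) (γ : ℕ →₀ ℕ) (k : ℕ) :
    kpSw i γ k = if k = i then γ (i + 1) else if k = i + 1 then γ i else γ k := by
  rw [kpSw, Finsupp.equivMapDomain_apply, Equiv.symm_swap, Equiv.swap_apply_def]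
  split_ifs <;> rfl

lemma kpSw_sw (i : ℕ) (γ : ℕ →₀ ℕ) : kpSw i (kpSw i γ) = γ := by
  ext k
  simp only [kpSw_apply]
  grind

/-- Key polynomials, with the number of steps recorded. -/
inductive kpKey : ℕ → (ℕ →₀ ℕ) → MvPolynomial ℕ ℤ → Prop
  | base (γ : ℕ →₀ ℕ) (hγ : ∀ i j : ℕ, i ≤ j → γ j ≤ γ i) : kpKey 0 γ (monomial γ 1)
  | step (m : ℕ) (γ : ℕ →₀ ℕ) (i : ℕ) (h : γ (i + 1) < γ i) (f : MvPolynomial ℕ ℤ)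
      (hf : kpKey m γ f) : kpKey (m + 1) (kpSw i γ) (kpXi i f)

lemma kp_key_of_isKey {γ : ℕ →₀ ℕ} {f : MvPolynomial ℕ ℤ} (h : IsKey γ f) :
    ∃ m, kpKey m γ f := by
  induction h with
  | base γ hγ => exact ⟨0, .base γ hγ⟩
  | step γ i h f g hf hg ih =>
    obtain ⟨m, hm⟩ := ih
    rw [kp_xi_eq hg]
    exact ⟨m + 1, .step m γ i h f hm⟩

lemma kp_main (m : ℕ) : ∀ (γ : ℕ →₀ ℕ) (f : MvPolynomial ℕ ℤ), kpKey m γ f →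
    ∀ j, γ j ≤ γ (j + 1) → kpS j f = f ∧ (γ j < γ (j + 1) →
      ∃ m' f', m = m' + 1 ∧ kpKey m' (kpSw j γ) f' ∧ f = kpXi j f') := by
  induction m using Nat.strong_induction_on with
  | _ m IH =>
  intro γ f hf j hj
  -- it suffices to prove the second part and the first part separately
  cases hf with
  | base _ hγ =>
    have h1 : γ j = γ (j + 1) := le_antisymm hj (hγ j (j + 1) (by omega))
    refine ⟨?_, fun h => absurd h1 h.ne⟩
    rw [kpS_def, rename_monomial]
    congr 2
    rw [← Finsupp.equivMapDomain_eq_mapDomain]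
    change kpSw j γ = γ
    ext k
    rw [kpSw_apply]
    grind
  | step m' γ' i h f' hf' =>
    by_cases hij : i = j
    · subst hij
      refine ⟨kp_xi_sym i f', fun _ => ⟨m', f', rfl, ?_, rfl⟩⟩
      rwa [kpSw_sw]
    · by_cases hfar : i + 1 < j ∨ j + 1 < i
      · have h1 : kpSw i γ' j = γ' j := by rw [kpSw_apply]; grind
        have h2 : kpSw i γ' (j + 1) = γ' (j + 1) := by rw [kpSw_apply]; grind
        rw [h1, h2] at hj ⊢
        obtain ⟨c1, c2⟩ := IH m' (by omega) γ' f' hf' j hj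
        have c2' : γ' j < γ' (j + 1) → ∃ m'_1 f'_1, m' + 1 = m'_1 + 1 ∧
            kpKey m'_1 (kpSw j (kpSw i γ')) f'_1 ∧ kpXi i f' = kpXi j f'_1 := by
          intro hlt
          obtain ⟨m'', f'', rfl, hk, rfl⟩ := c2 hlt
          refine ⟨m'' + 1, kpXi i f'', rfl, ?_, kp_xi_comm i j hfar f''⟩
          have : kpSw j (kpSw i γ') = kpSw i (kpSw j γ') := by
            ext k
            simp only [kpSw_apply]
            grind
          rw [this]
          refine .step m'' _ i ?_ f'' hk
          simp only [kpSw_apply]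
          grind
        refine ⟨?_, c2'⟩
        rw [← kp_xi_of_sym j f' c1, kp_xi_comm i j hfar, kp_xi_sym]
      · have hadj : j = i + 1 ∨ i = j + 1 := by omega
        have h1 : γ' j < γ' (j + 1) := by
          simp only [kpSw_apply] at hj
          grind
        obtain ⟨-, c2⟩ := IH m' (by omega) γ' f' hf' j h1.le
        obtain ⟨m'', f'', rfl, hk, rfl⟩ := c2 h1
        have h2 : kpSw j γ' i ≤ kpSw j γ' (i + 1) := by
          simp only [kpSw_apply] at hj ⊢
          grind
        obtain ⟨d1, d2⟩ := IH m'' (by omega) _ f'' hk i h2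
        constructor
        · rw [← kp_xi_of_sym i f'' d1, kp_xi_braid i j hadj, kp_xi_sym]
        · intro hlt
          have h3 : kpSw j γ' i < kpSw j γ' (i + 1) := by
            simp only [kpSw_apply] at hlt ⊢
            grind
          obtain ⟨m3, f3, rfl, hk3, rfl⟩ := d2 h3
          refine ⟨m3 + 1 + 1, kpXi i (kpXi j f3), rfl, ?_, kp_xi_braid i j hadj f3⟩
          have e : kpSw j (kpSw i γ') = kpSw i (kpSw j (kpSw i (kpSw j γ'))) := by
            ext k
            simp only [kpSw_apply]
            grind
          rw [e]
          refine .step _ _ i ?_ _ (.step _ _ j ?_ _ hk3)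
          · simp only [kpSw_apply] at hlt h h1 ⊢
            grind
          · simp only [kpSw_apply] at hlt h h1 ⊢
            grind

/-! ### Part 3: antisymmetrisation -/

/-- Extension of a permutation of `Fin n` to `ℕ`. -/
def kpExt (n : ℕ) (σ : Equiv.Perm (Fin n)) : Equiv.Perm ℕ := σ.extendDomain Fin.equivSubtype

lemma kpExt_val (n : ℕ) (σ : Equiv.Perm (Fin n)) (k : Fin n) : kpExt n σ k = (σ k : ℕ) :=
  Equiv.Perm.extendDomain_apply_image σ Fin.equivSubtype k

lemma kpExt_mul (n : ℕ) (σ τ : Equiv.Perm (Fin n)) : kpExt n (σ * τ) = kpExt n σ * kpExt n τ :=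
  (Equiv.Perm.extendDomain_mul _ _ _).symm

lemma kpExt_one (n : ℕ) : kpExt n 1 = 1 := Equiv.Perm.extendDomain_one _

lemma kpExt_swap (n i : ℕ) (h : i + 1 < n) :
    kpExt n (Equiv.swap ⟨i, by omega⟩ ⟨i + 1, h⟩) = Equiv.swap i (i + 1) := by
  ext x
  by_cases hx : x < n
  · have := kpExt_val n (Equiv.swap ⟨i, by omega⟩ ⟨i + 1, h⟩) ⟨x, hx⟩
    simp only at this
    rw [this]
    simp only [Equiv.swap_apply_def, Fin.mk.injEq]
    split_ifs <;> rfl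
  · rw [kpExt, Equiv.Perm.extendDomain_apply_not_subtype (p := fun y => y < n) _ _ hx,
      Equiv.swap_apply_of_ne_of_ne (by omega) (by omega)]

/-- The antisymmetriser. -/
noncomputable def kpA (n : ℕ) (f : MvPolynomial ℕ ℤ) : MvPolynomial ℕ ℤ :=
  ∑ σ : Equiv.Perm (Fin n), (Equiv.Perm.sign σ : ℤ) • rename (kpExt n σ) f

lemma kpA_sub (n : ℕ) (f g : MvPolynomial ℕ ℤ) : kpA n (f - g) = kpA n f - kpA n g := by
  simp [kpA, smul_sub, Finset.sum_sub_distrib]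

lemma kpA_swap (n i : ℕ) (h : i + 1 < n) (f : MvPolynomial ℕ ℤ) :
    kpA n (kpS i f) = - kpA n f := by
  rw [kpA, kpA, ← Finset.sum_neg_distrib]
  refine Fintype.sum_equiv (Equiv.mulRight (Equiv.swap ⟨i, by omega⟩ ⟨i + 1, h⟩)) _ _ ?_
  intro σ
  rw [Equiv.coe_mulRight, kpS_def, rename_rename, kpExt_mul, kpExt_swap, Equiv.Perm.sign_mul,
    Equiv.Perm.sign_swap (by simp)]
  simp [Equiv.Perm.coe_mul]

lemma kp_inv (n : ℕ) (f : MvPolynomial ℕ ℤ) (hf : ∀ i, i + 1 < n → kpS i f = f)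
    (σ : Equiv.Perm (Fin n)) : rename (kpExt n σ) f = f := by
  cases n with
  | zero =>
    rw [Subsingleton.elim σ 1, kpExt_one]
    simp
  | succ n =>
    have hσ : σ ∈ Submonoid.closure
        (Set.range fun i : Fin n => Equiv.swap i.castSucc i.succ) := by
      rw [Equiv.Perm.mclosure_swap_castSucc_succ]; trivial
    induction hσ using Submonoid.closure_induction_left with
    | one => rw [kpExt_one]; simp
    | mul_left x hx y hy ih =>
      obtain ⟨i, rfl⟩ := hx
      have e := kpExt_swap (n + 1) i (by omega)
      have e' : kpExt (n + 1) (Equiv.swap i.castSucc i.succ) = Equiv.swap (i : ℕ) (i + 1) := e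
      simp only
      rw [kpExt_mul, Equiv.Perm.coe_mul, ← rename_rename, ih, e', ← kpS_def]
      exact hf i (by omega)

lemma kpA_mul_inv (n : ℕ) (u f : MvPolynomial ℕ ℤ) (hf : ∀ i, i + 1 < n → kpS i f = f) :
    kpA n (u * f) = kpA n u * f := by
  rw [kpA, kpA, Finset.sum_mul]
  refine Finset.sum_congr rfl fun σ _ => ?_
  rw [map_mul, kp_inv n f hf, smul_mul_assoc]

/-- The monomial `∏ x_k ^ a_k`. -/
noncomputable def kpMon (n : ℕ) (a : ℕ → ℕ) : MvPolynomial ℕ ℤ :=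
  ∏ k : Fin n, X (k : ℕ) ^ a k

lemma kpA_mon (n : ℕ) (lam : Fin n → ℕ) (a : ℕ → ℕ) (ha : ∀ k : Fin n, a k = lam k + (n - 1 - k)) :
    kpA n (kpMon n a) = rename (Fin.val : Fin n → ℕ) (kpV n lam).det := by
  rw [← Matrix.det_transpose, Matrix.det_apply, map_sum, kpA]
  refine Finset.sum_congr rfl fun σ _ => ?_
  rw [kpMon, Units.smul_def, map_zsmul, map_prod, map_prod]
  congr 1
  refine Finset.prod_congr rfl fun k _ => ?_
  simp [kpV, ha, kpExt_val]

lemma kp_rho (n i : ℕ) (h : i + 1 < n) :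
    ∃ u, kpS i u = u ∧ kpMon n (fun k => n - 1 - k) = X i * u := by
  refine ⟨kpMon n (fun k => if k = i then n - 2 - i else n - 1 - k), ?_, ?_⟩
  · rw [kpMon, map_prod]
    refine Fintype.prod_equiv (Equiv.swap ⟨i, by omega⟩ ⟨i + 1, h⟩) _ _ ?_
    intro k
    rw [← kpExt_val, kpExt_swap, map_pow, kpS_def, rename_X]
    congr 1
    rw [Equiv.swap_apply_def]
    grind
  · have key : ∀ a : ℕ → ℕ, kpMon n a =
        X i ^ a i * ∏ k ∈ Finset.univ.erase (⟨i, by omega⟩ : Fin n), X (k : ℕ) ^ a k := by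
      intro a
      rw [kpMon, ← Finset.mul_prod_erase _ _ (Finset.mem_univ (⟨i, by omega⟩ : Fin n))]
    rw [key, key, ← mul_assoc, if_pos rfl, ← pow_succ']
    congr 1
    · congr 1
      omega
    · refine Finset.prod_congr rfl fun k hk => ?_
      rw [if_neg]
      intro hki
      exact (Finset.mem_erase.1 hk).1 (Fin.ext hki)

lemma kpA_xi (n i : ℕ) (h : i + 1 < n) (f : MvPolynomial ℕ ℤ) :
    kpA n (kpMon n (fun k => n - 1 - k) * kpXi i f)
      = kpA n (kpMon n (fun k => n - 1 - k) * f) := by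
  obtain ⟨u, hu, hr⟩ := kp_rho n i h
  rw [hr]
  have e := kp_spec' i f
  have e1 : X i * u * kpXi i f - kpS i (X i * u * kpXi i f)
      = X i * u * f - kpS i (X i * u * f) := by
    simp only [map_mul, kpS_X_left, hu, kp_xi_sym]
    linear_combination u * e
  have e2 := congrArg (kpA n) e1
  rw [kpA_sub, kpA_sub, kpA_swap n i h, kpA_swap n i h] at e2
  have e3 : (2 : MvPolynomial ℕ ℤ) * kpA n (X i * u * kpXi i f)
      = 2 * kpA n (X i * u * f) := by
    linear_combination e2
  exact mul_left_cancel₀ two_ne_zero e3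

lemma kp_monomial (n : ℕ) (γ : ℕ →₀ ℕ) (h : ∀ j, n ≤ j → γ j = 0) :
    (monomial γ 1 : MvPolynomial ℕ ℤ) = kpMon n γ := by
  rw [monomial_eq, C_1, one_mul, kpMon, Fin.prod_univ_eq_prod_range
    (fun k => (X k : MvPolynomial ℕ ℤ) ^ γ k)]
  refine Finsupp.prod_of_support_subset _ ?_ _ (by simp)
  intro k hk
  rw [Finset.mem_range]
  by_contra hc
  exact (Finsupp.mem_support_iff.1 hk) (h k (by omega))

lemma kpA_key (n : ℕ) (lam : Fin n → ℕ) (hlam : Antitone lam) (m : ℕ) (γ : ℕ →₀ ℕ)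
    (f : MvPolynomial ℕ ℤ) (hf : kpKey m γ f) :
    (∀ j, n ≤ j → γ j = 0) → (∃ σ : Equiv.Perm (Fin n), ∀ k : Fin n, γ k = lam (σ k)) →
    kpA n (kpMon n (fun k => n - 1 - k) * f) =
      rename (Fin.val : Fin n → ℕ) (kpV n lam).det := by
  induction hf with
  | base γ hγ =>
    rintro h0 ⟨σ, hσ⟩
    rw [kp_monomial n γ h0, kpMon, kpMon, ← Finset.prod_mul_distrib]
    simp only [← pow_add]
    refine kpA_mon n lam (fun k => n - 1 - k + γ k) ?_
    intro k
    have h1 : Antitone (lam ∘ σ) := by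
      intro a b hab
      simp only [Function.comp, ← hσ]
      exact hγ _ _ hab
    have h2 : lam ∘ σ = lam ∘ (1 : Equiv.Perm (Fin n)) := Tuple.unique_antitone h1 hlam
    have h3 := congrFun h2 k
    simp only [Function.comp, ← hσ] at h3
    simp only [h3, Equiv.Perm.one_apply]
    omega
  | step m γ i h f hf ih =>
    rintro h0 ⟨σ, hσ⟩
    have hi : i + 1 < n := by
      by_contra hc
      have := h0 (i + 1) (by omega)
      simp [kpSw_apply] at this
      omega
    rw [kpA_xi n i hi]
    refine ih ?_ ⟨σ * Equiv.swap ⟨i, by omega⟩ ⟨i + 1, hi⟩, ?_⟩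
    · intro j hj
      have := h0 j hj
      rw [kpSw_apply, if_neg (by omega), if_neg (by omega)] at this
      exact this
    · intro k
      rw [Equiv.Perm.mul_apply, ← hσ, ← kpExt_val, kpExt_swap, kpSw_apply,
        Equiv.swap_apply_def]
      grind

/-- For a partition `λ` with at most `n` parts, the key polynomial
indexed by the reversed (weakly increasing) composition `rev(λ) = (λ_n,…,λ_1)`
(padded with zeros to length `n`) equals the Schur polynomial `s_λ(x_1,…,x_n)`.
Variables are `0`-indexed by `ℕ`; `γ` encodes `rev(λ)` via `γ_{n-1-i} = λ_i` and
`γ_j = 0` for `j ≥ n`, and the Schur polynomial in the first `n` variables is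
obtained via the renaming `Fin.val : Fin n → ℕ`. -/
theorem key_poly_of_rev_partition_eq_schur
    (n : ℕ) (lam : Fin n → ℕ) (hlam : Antitone lam)
    (γ : ℕ →₀ ℕ)
    (hrev : ∀ i : Fin n, γ (n - 1 - (i : ℕ)) = lam i)
    (hzero : ∀ j, n ≤ j → γ j = 0)
    (f : MvPolynomial ℕ ℤ) (hf : IsKey γ f) :
    f = rename (Fin.val : Fin n → ℕ) (schurJT n n lam) := by
  obtain ⟨m, hm⟩ := kp_key_of_isKey hf
  have hγ : ∀ k : Fin n, γ k = lam (Fin.revPerm k) := by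
    intro k
    rw [← hrev, Fin.revPerm_apply, Fin.val_rev]
    congr 1
    omega
  have hA := kpA_key n lam hlam m γ f hm hzero ⟨Fin.revPerm, hγ⟩
  have hsym : ∀ i, i + 1 < n → kpS i f = f := by
    intro i hi
    refine (kp_main m γ f hm i ?_).1
    have h1 := hγ ⟨i, by omega⟩
    have h2 := hγ ⟨i + 1, hi⟩
    simp only at h1 h2
    rw [h1, h2]
    apply hlam
    rw [Fin.revPerm_apply, Fin.revPerm_apply, Fin.rev_le_rev]
    exact Nat.le_succ i
  rw [kpA_mul_inv n _ f hsym, kpA_mon n (fun _ => 0) _ (by simp), kp_bialternant n lam, map_mul,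
    mul_comm] at hA
  refine mul_right_cancel₀ ?_ hA
  intro h0
  exact kp_V_ne n (rename_injective _ Fin.val_injective (h0.trans (map_zero _).symm))
end

section
/- For any composition γ ∈ ℤ_{≥0}^n, the key polynomial K_γ(x_1,…,x_n) has nonnegative integer coefficients. -/
open MvPolynomial

namespace KeyPos

/-! ### Abstract 0-Hecke words -/
section Hecke

variable {M : Type*} [Monoid M]

/-- The product `ξ_{k+l-1} ⋯ ξ_{k+1} ξ_k`. -/
def cc (ξ : ℕ → M) (k : ℕ) : ℕ → M
  | 0 => 1
  | l + 1 => ξ (k + l) * cc ξ k l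

/-- Words in the letters `ξ_i`, `k ≤ i < n`. -/
def Wd (ξ : ℕ → M) (k n : ℕ) : Submonoid M :=
  Submonoid.closure {x | ∃ i, k ≤ i ∧ i < n ∧ x = ξ i}

lemma Wd_gen (ξ : ℕ → M) {k n i : ℕ} (h1 : k ≤ i) (h2 : i < n) : ξ i ∈ Wd ξ k n :=
  Submonoid.subset_closure ⟨i, h1, h2, rfl⟩

lemma Wd_mono (ξ : ℕ → M) {k n k' n' : ℕ} (h1 : k' ≤ k) (h2 : n ≤ n') :
    Wd ξ k n ≤ Wd ξ k' n' := by
  apply Submonoid.closure_mono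
  rintro x ⟨i, a, b, rfl⟩
  exact ⟨i, by omega, by omega, rfl⟩

lemma cc_mem (ξ : ℕ → M) (k l : ℕ) : cc ξ k l ∈ Wd ξ k (k + l) := by
  induction l with
  | zero => exact Submonoid.one_mem _
  | succ l ih =>
    exact Submonoid.mul_mem _ (Wd_gen ξ (by omega) (by omega))
      (Wd_mono ξ le_rfl (by omega) ih)

lemma cc_succ_right (ξ : ℕ → M) (k l : ℕ) : cc ξ k (l + 1) = cc ξ (k + 1) l * ξ k := by
  induction l with
  | zero => simp [cc]
  | succ l ih =>
    rw [cc, ih, cc, ← mul_assoc]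
    congr 3
    omega

lemma Wd_commute (ξ : ℕ → M) (hc : ∀ i j, i + 2 ≤ j → ξ i * ξ j = ξ j * ξ i)
    {k n j : ℕ} (hj : n + 1 ≤ j) {u : M} (hu : u ∈ Wd ξ k n) : u * ξ j = ξ j * u := by
  induction hu using Submonoid.closure_induction with
  | mem x hx =>
    obtain ⟨i, a, b, rfl⟩ := hx
    exact hc _ _ (by omega)
  | one => simp
  | mul x y _ _ hx hy => rw [mul_assoc, hy, ← mul_assoc, hx, mul_assoc]

lemma rel_A (ξ : ℕ → M)
    (hc : ∀ i j, i + 2 ≤ j → ξ i * ξ j = ξ j * ξ i)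
    (hb : ∀ i, ξ i * ξ (i + 1) * ξ i = ξ (i + 1) * ξ i * ξ (i + 1))
    (k l j : ℕ) (h1 : k ≤ j) (h2 : j + 1 < k + l) :
    ξ j * cc ξ k l = cc ξ k l * ξ (j + 1) := by
  induction l with
  | zero => omega
  | succ l ih =>
    by_cases h : j + 1 < k + l
    · rw [cc, ← mul_assoc, hc j (k + l) (by omega), mul_assoc, ih h, mul_assoc]
    · obtain ⟨l, rfl⟩ : ∃ l', l = l' + 1 := ⟨l - 1, by omega⟩
      obtain rfl : j = k + l := by omega
      have hcm : cc ξ k l * ξ (k + l + 1) = ξ (k + l + 1) * cc ξ k l :=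
        Wd_commute ξ hc (by omega) (cc_mem ξ k l)
      have e : cc ξ k (l + 1 + 1) = ξ (k + l + 1) * (ξ (k + l) * cc ξ k l) := rfl
      rw [e, mul_assoc, mul_assoc, hcm]
      have := hb (k + l)
      calc _ = (ξ (k + l) * ξ (k + l + 1) * ξ (k + l)) * cc ξ k l := by simp only [mul_assoc]
        _ = _ := by rw [this]; simp only [mul_assoc]

lemma rel_B (ξ : ℕ → M)
    (hc : ∀ i j, i + 2 ≤ j → ξ i * ξ j = ξ j * ξ i)
    (hb : ∀ i, ξ i * ξ (i + 1) * ξ i = ξ (i + 1) * ξ i * ξ (i + 1))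
    (k l q r : ℕ) (h1 : k ≤ q) (h2 : q + r < k + l) :
    cc ξ q r * cc ξ k l = cc ξ k l * cc ξ (q + 1) r := by
  induction r with
  | zero => simp [cc]
  | succ r ih =>
    rw [cc, mul_assoc, ih (by omega), ← mul_assoc, rel_A ξ hc hb k l _ (by omega) (by omega), cc,
      mul_assoc]
    congr 3
    omega

lemma rel_C (ξ : ℕ → M)
    (hi : ∀ i, ξ i * ξ i = ξ i)
    (k l : ℕ) : ξ (k + l) * cc ξ k (l + 1) = cc ξ k (l + 1) := by
  rw [cc, ← mul_assoc, hi]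

lemma normal_form (ξ : ℕ → M)
    (hc : ∀ i j, i + 2 ≤ j → ξ i * ξ j = ξ j * ξ i)
    (hb : ∀ i, ξ i * ξ (i + 1) * ξ i = ξ (i + 1) * ξ i * ξ (i + 1))
    (hi : ∀ i, ξ i * ξ i = ξ i)
    (n : ℕ) : ∀ w ∈ Wd ξ 0 (n + 1),
    ∃ u ∈ Wd ξ 0 n, ∃ k l, k + l = n + 1 ∧ w = u * cc ξ k l := by
  induction n with
  | zero =>
    intro w hw
    induction hw using Submonoid.closure_induction_left with
    | one => exact ⟨1, Submonoid.one_mem _, 1, 0, rfl, by simp [cc]⟩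
    | mul_left x hx y hy ih =>
      obtain ⟨i, -, hi', rfl⟩ := hx
      obtain rfl : i = 0 := by omega
      obtain ⟨u, hu, k, l, hkl, rfl⟩ := ih
      have hu1 : u = 1 := by
        have hbot : Wd ξ 0 0 ≤ ⊥ := by
          rw [Wd, Submonoid.closure_le]
          rintro x ⟨i, _, h, _⟩
          omega
        exact hbot hu
      subst hu1
      refine ⟨1, Submonoid.one_mem _, 0, 1, rfl, ?_⟩
      rcases l with _ | l
      · simp [cc]
      · obtain rfl : l = 0 := by omega
        obtain rfl : k = 0 := by omega
        simp [cc, hi]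
  | succ n ihn =>
    intro w hw
    induction hw using Submonoid.closure_induction_left with
    | one => exact ⟨1, Submonoid.one_mem _, n + 2, 0, rfl, by simp [cc]⟩
    | mul_left x hx y hy ih =>
      obtain ⟨i, -, hin, rfl⟩ := hx
      obtain ⟨u, hu, k, l, hkl, rfl⟩ := ih
      by_cases hin' : i < n + 1
      · exact ⟨ξ i * u, Submonoid.mul_mem _ (Wd_gen ξ (by omega) hin') hu, k, l, hkl,
          by rw [mul_assoc]⟩
      obtain rfl : i = n + 1 := by omega
      obtain ⟨v, hv, m, r, hmr, rfl⟩ := ihn u hu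
      have hv' : v ∈ Wd ξ 0 (n + 1) := Wd_mono ξ le_rfl (by omega) hv
      have hcm := Wd_commute ξ hc (j := n + 1) le_rfl hv
      have e1 : ξ (n + 1) * (v * cc ξ m r * cc ξ k l) = v * (cc ξ m (r + 1) * cc ξ k l) := by
        rw [cc, ← mul_assoc, ← mul_assoc, ← hcm, hmr]
        simp only [mul_assoc]
      rw [e1]
      by_cases hkm : k ≤ m
      · obtain ⟨l, rfl⟩ : ∃ l', l = l' + 1 := ⟨l - 1, by omega⟩
        refine ⟨v * cc ξ m r, hu, k, l + 1, hkl, ?_⟩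
        rw [mul_assoc]
        congr 1
        rw [cc, mul_assoc, rel_B ξ hc hb k (l + 1) m r hkm (by omega), ← mul_assoc]
        have : m + r = k + l := by omega
        rw [this, rel_C ξ hi]
      · obtain ⟨q, rfl⟩ : ∃ q, k = q + 1 := ⟨k - 1, by omega⟩
        refine ⟨v * cc ξ q l, Submonoid.mul_mem _ hv' ?_, m, r + 1, by omega, ?_⟩
        · exact Wd_mono ξ (by omega) (by omega) (cc_mem ξ q l)
        · rw [mul_assoc, rel_B ξ hc hb m (r + 1) q l (by omega) (by omega)]

end Hecke

/-! ### The operators `ξ_i` -/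

/-- Polynomials. -/
abbrev P := MvPolynomial ℕ ℤ

/-- The simple transposition acting on polynomials. -/
noncomputable def s (i : ℕ) : P →ₐ[ℤ] P := rename (Equiv.swap i (i + 1))

lemma s_X_left (i : ℕ) : s i (X i) = X (i + 1) := by simp [s]
lemma s_X_right (i : ℕ) : s i (X (i + 1)) = X i := by simp [s]
lemma s_X_ne (i j : ℕ) (h1 : j ≠ i) (h2 : j ≠ i + 1) : s i (X j) = X j := by
  simp [s, Equiv.swap_apply_of_ne_of_ne h1 h2]

lemma s_s (i : ℕ) (f : P) : s i (s i f) = f := by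
  simp only [s, rename_rename]
  convert rename_id_apply f
  ext x
  simp

lemma s_comm (i j : ℕ) (h : i + 2 ≤ j) (f : P) : s i (s j f) = s j (s i f) := by
  simp only [s, rename_rename]
  congr 2
  ext x
  simp only [Function.comp, Equiv.swap_apply_def]
  grind

lemma s_braid (i : ℕ) (f : P) : s i (s (i + 1) (s i f)) = s (i + 1) (s i (s (i + 1) f)) := by
  simp only [s, rename_rename]
  congr 2
  ext x
  simp only [Function.comp, Equiv.swap_apply_def]
  grind

lemma X_sub_ne {i j : ℕ} (h : i ≠ j) : (X i - X j : P) ≠ 0 := by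
  rw [sub_ne_zero]
  intro h'
  exact h (X_injective h')

lemma dvd_sub_s (i : ℕ) (f : P) : (X i - X (i + 1) : P) ∣ f - s i f := by
  induction f using MvPolynomial.induction_on with
  | C a => simp [s]
  | add p q hp hq =>
    have : p + q - s i (p + q) = (p - s i p) + (q - s i q) := by rw [map_add]; ring
    rw [this]
    exact dvd_add hp hq
  | mul_X p k hp =>
    have : p * X k - s i (p * X k) = (p - s i p) * X k + s i p * (X k - s i (X k)) := by
      rw [map_mul]; ring
    rw [this]
    refine dvd_add (hp.mul_right _) (Dvd.dvd.mul_left ?_ _)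
    by_cases h1 : k = i
    · subst h1; rw [s_X_left]
    · by_cases h2 : k = i + 1
      · subst h2; rw [s_X_right]; exact ⟨-1, by ring⟩
      · rw [s_X_ne i k h1 h2]; simp

lemma exists_xi (i : ℕ) (f : P) :
    ∃ g : P, (X i - X (i + 1)) * g = X i * f - X (i + 1) * s i f := by
  obtain ⟨h, hh⟩ := dvd_sub_s i f
  refine ⟨f + X (i + 1) * h, ?_⟩
  linear_combination (-X (i + 1)) * hh

/-- The underlying function of `ξ_i`. -/
noncomputable def xiFun (i : ℕ) (f : P) : P := (exists_xi i f).choose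

lemma xiFun_spec (i : ℕ) (f : P) :
    (X i - X (i + 1)) * xiFun i f = X i * f - X (i + 1) * s i f := (exists_xi i f).choose_spec

lemma succ_ne' (i : ℕ) : i ≠ i + 1 := by omega

/-- The Demazure operator `ξ_i`. -/
noncomputable def xi (i : ℕ) : Module.End ℤ P where
  toFun := xiFun i
  map_add' f g := by
    apply mul_left_cancel₀ (X_sub_ne (succ_ne' i))
    rw [mul_add, xiFun_spec, xiFun_spec, xiFun_spec, map_add]
    ring
  map_smul' a f := by
    apply mul_left_cancel₀ (X_sub_ne (succ_ne' i))
    simp only [RingHom.id_apply]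
    rw [mul_smul_comm, xiFun_spec, xiFun_spec, map_smul]
    simp only [smul_eq_C_mul]
    ring

lemma xi_spec (i : ℕ) (f : P) :
    (X i - X (i + 1)) * xi i f = X i * f - X (i + 1) * s i f := xiFun_spec i f

lemma xi_unique (i : ℕ) (f g : P)
    (h : (X i - X (i + 1)) * g = X i * f - X (i + 1) * s i f) : g = xi i f := by
  apply mul_left_cancel₀ (X_sub_ne (succ_ne' i))
  rw [h, xi_spec]

lemma xi_mul (i : ℕ) (g f : P) (hg : s i g = g) : xi i (g * f) = g * xi i f := by
  symm
  apply xi_unique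
  rw [map_mul, hg]
  linear_combination g * xi_spec i f

lemma s_xi (i : ℕ) (f : P) : s i (xi i f) = xi i f := by
  apply xi_unique
  have := congrArg (s i) (xi_spec i f)
  simp only [map_mul, map_sub, s_X_left, s_X_right, s_s] at this
  linear_combination -this

lemma xi_idem_apply (i : ℕ) (f : P) : xi i (xi i f) = xi i f := by
  symm
  apply xi_unique
  rw [s_xi]
  ring

lemma s_xi_comm (i j : ℕ) (h : i + 2 ≤ j) (f : P) : s j (xi i f) = xi i (s j f) := by
  apply xi_unique
  have := congrArg (s j) (xi_spec i f)
  simp only [map_mul, map_sub] at this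
  rw [s_X_ne j i (by omega) (by omega), s_X_ne j (i + 1) (by omega) (by omega)] at this
  rw [this, s_comm i j h]

lemma xi_comm_apply (i j : ℕ) (h : i + 2 ≤ j) (f : P) : xi i (xi j f) = xi j (xi i f) := by
  apply xi_unique
  rw [s_xi_comm i j h]
  have e1 : s i (X j : P) = X j := s_X_ne i j (by omega) (by omega)
  have e2 : s i (X (j + 1) : P) = X (j + 1) := s_X_ne i (j + 1) (by omega) (by omega)
  rw [← xi_mul i (X j) _ e1, ← xi_mul i (X (j + 1)) _ e2, ← map_sub, ← xi_spec j f,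
    xi_mul]
  rw [map_sub, e1, e2]

lemma xi_braid_apply (i : ℕ) (f : P) :
    xi i (xi (i + 1) (xi i f)) = xi (i + 1) (xi i (xi (i + 1) f)) := by
  have hab : (X i - X (i + 1) : P) ≠ 0 := X_sub_ne (by omega)
  have hbc : (X (i + 1) - X (i + 1 + 1) : P) ≠ 0 := X_sub_ne (by omega)
  have hac : (X i - X (i + 1 + 1) : P) ≠ 0 := X_sub_ne (by omega)
  have ta := s_X_left i
  have tb := s_X_right i
  have tc := s_X_ne i (i + 1 + 1) (by omega) (by omega)
  have ua := s_X_ne (i + 1) i (by omega) (by omega)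
  have ub := s_X_left (i + 1)
  have uc := s_X_right (i + 1)
  have br := s_braid i f
  -- the left-hand side
  have g0 := xi_spec i f
  have g2 := congrArg (s (i + 1)) g0
  have g12 := congrArg (s i) g2
  have gs := s_xi i f
  have h0 := xi_spec (i + 1) (xi i f)
  have h1 := congrArg (s i) h0
  have p0 := xi_spec i (xi (i + 1) (xi i f))
  -- the right-hand side
  have k0 := xi_spec (i + 1) f
  have k1 := congrArg (s i) k0
  have k21 := congrArg (s (i + 1)) k1
  have ks := s_xi (i + 1) f
  have l0 := xi_spec i (xi (i + 1) f)
  have l2 := congrArg (s (i + 1)) l0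
  have q0 := xi_spec (i + 1) (xi i (xi (i + 1) f))
  simp only [map_mul, map_sub, ta, tb, tc, ua, ub, uc, gs, ks] at g2 g12 h1 k1 k21 l2
  rw [← br] at k21
  generalize xi i (xi (i + 1) (xi i f)) = p at *
  generalize xi (i + 1) (xi i (xi (i + 1) f)) = q at *
  generalize s i (xi (i + 1) (xi i f)) = sh at *
  generalize xi (i + 1) (xi i f) = h at *
  generalize s (i + 1) (xi i (xi (i + 1) f)) = sl at *
  generalize xi i (xi (i + 1) f) = l at *
  generalize s i (s (i + 1) (xi i f)) = sg12 at *
  generalize s (i + 1) (xi i f) = sg2 at *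
  generalize xi i f = g at *
  generalize s (i + 1) (s i (xi (i + 1) f)) = sk21 at *
  generalize s i (xi (i + 1) f) = sk1 at *
  generalize xi (i + 1) f = k at *
  generalize s i (s (i + 1) (s i f)) = f121 at *
  generalize s i (s (i + 1) f) = f12 at *
  generalize s (i + 1) (s i f) = f21 at *
  generalize s i f = f1 at *
  generalize s (i + 1) f = f2 at *
  generalize (X i : P) = a at *
  generalize (X (i + 1) : P) = b at *
  generalize (X (i + 1 + 1) : P) = c at *
  have key : ((a - b) * (b - c) * (a - c)) * p = ((a - b) * (b - c) * (a - c)) * q := by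
    linear_combination (b - c) * (a - c) * p0 + a * (a - c) * h0 - b * (b - c) * h1 + a * b * g0
      - a * c * g2 + b * c * g12 - ((a - b) * (a - c) * q0 + b * (a - c) * l0
      - c * (a - b) * l2 + a ^ 2 * k0 - b ^ 2 * k1 + c ^ 2 * k21)
  exact mul_left_cancel₀ (mul_ne_zero (mul_ne_zero hab hbc) hac) key

lemma nf (n : ℕ) : ∀ w ∈ Wd xi 0 (n + 1),
    ∃ u ∈ Wd xi 0 n, ∃ k l, k + l = n + 1 ∧ w = u * cc xi k l :=
  normal_form xi (fun i j h => LinearMap.ext fun f => xi_comm_apply i j h f)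
    (fun i => LinearMap.ext fun f => xi_braid_apply i f)
    (fun i => LinearMap.ext fun f => xi_idem_apply i f) n

/-! ### Monomials -/

/-- The monomial `x^z`. -/
noncomputable def mon (z : ℕ →₀ ℕ) : P := monomial z (1 : ℤ)

lemma mon_add (y z : ℕ →₀ ℕ) : mon (y + z) = mon y * mon z := by
  simp [mon, monomial_mul]

lemma mon_single (k t : ℕ) : mon (Finsupp.single k t) = X k ^ t := by
  rw [mon, X_pow_eq_monomial]

lemma s_mon (i : ℕ) (z : ℕ →₀ ℕ) (h1 : z i = 0) (h2 : z (i + 1) = 0) : s i (mon z) = mon z := by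
  rw [mon, s, rename_monomial]
  suffices h : Finsupp.mapDomain (Equiv.swap i (i + 1)) z = z by rw [h]
  rw [← Finsupp.equivMapDomain_eq_mapDomain]
  ext p
  simp only [Finsupp.equivMapDomain_apply, Equiv.symm_swap, Equiv.swap_apply_def]
  split_ifs with h h'
  · rw [h, h1, h2]
  · rw [h', h1, h2]
  · rfl

lemma Wd_mul {k n : ℕ} (g : P) (hg : ∀ i, k ≤ i → i < n → s i g = g) {L : Module.End ℤ P}
    (hL : L ∈ Wd xi k n) : ∀ f : P, L (g * f) = g * L f := by
  induction hL using Submonoid.closure_induction with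
  | mem x hx =>
    obtain ⟨i, a, b, rfl⟩ := hx
    exact fun f => xi_mul i g f (hg i a b)
  | one => intro f; rfl
  | mul x y _ _ hx hy =>
    intro f
    rw [Module.End.mul_apply, Module.End.mul_apply, hy, hx]

lemma Wd_mul_X {k n p : ℕ} (e : ℕ) (hp : p < k ∨ n < p) {L : Module.End ℤ P}
    (hL : L ∈ Wd xi k n) (f : P) : L (X p ^ e * f) = X p ^ e * L f := by
  refine Wd_mul _ (fun i h1 h2 => ?_) hL f
  rw [map_pow, s_X_ne i p (by omega) (by omega)]

lemma xi_string (k b d : ℕ) (g : P) (hg : s k g = g) :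
    xi k (X k ^ (b + d) * (X (k + 1) ^ b * g)) =
      ∑ i ∈ Finset.range (d + 1), X k ^ (b + d - i) * (X (k + 1) ^ (b + i) * g) := by
  symm
  apply xi_unique
  simp only [map_mul, map_pow, s_X_left, s_X_right, hg]
  have h := (Commute.all (X (k + 1) : P) (X k)).geom_sum₂_mul (d + 1)
  have e : ∑ i ∈ Finset.range (d + 1), (X k : P) ^ (b + d - i) * (X (k + 1) ^ (b + i) * g) =
      (X k ^ b * X (k + 1) ^ b * g) *
        ∑ i ∈ Finset.range (d + 1), X (k + 1) ^ i * X k ^ (d + 1 - 1 - i) := by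
    rw [Finset.mul_sum]
    refine Finset.sum_congr rfl fun i hi => ?_
    have : b + d - i = b + (d + 1 - 1 - i) := by
      have := Finset.mem_range.1 hi
      omega
    rw [this, pow_add, pow_add]
    ring
  rw [e]
  linear_combination (-(X k ^ b * X (k + 1) ^ b * g)) * h

/-! ### The branching formula -/

/-- Families `t ↦ L (x_k^t x^z)`. -/
noncomputable def Fam (lam : ℕ →₀ ℕ) (n k : ℕ) : AddSubmonoid (ℕ → P) :=
  AddSubmonoid.closure {Q | ∃ L ∈ Wd xi k n, ∃ z : ℕ →₀ ℕ, (∀ p, p ≤ k → z p = 0) ∧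
    (∀ p, k < p → p < n → z (p + 1) ≤ z p) ∧ (k < n → z (k + 1) ≤ lam (k + 1)) ∧
    Q = fun t => L (X k ^ t * mon z)}

lemma fam_step (lam : ℕ →₀ ℕ) (n k a c : ℕ) (hk : k < n) (ha : lam (k + 1 + 1) = a)
    (hb : lam (k + 1) = a + c) (Q : ℕ → P) (hQ : Q ∈ Fam lam n (k + 1)) :
    ∃ Q' ∈ Fam lam n k, ∀ e, Q' (a + c + e) =
      X k ^ (a + c + e) * ∑ r ∈ Finset.range c, X (n + 1) ^ (c - r) * Q (a + r) +
      ∑ r ∈ Finset.range (e + 1), X k ^ (a + c + e - r) * Q (a + c + r) := by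
  induction hQ using AddSubmonoid.closure_induction with
  | zero => exact ⟨0, AddSubmonoid.zero_mem _, fun e => by simp⟩
  | add Q₁ Q₂ _ _ h₁ h₂ =>
    obtain ⟨R₁, m₁, e₁⟩ := h₁
    obtain ⟨R₂, m₂, e₂⟩ := h₂
    refine ⟨R₁ + R₂, AddSubmonoid.add_mem _ m₁ m₂, fun e => ?_⟩
    simp only [Pi.add_apply, e₁, e₂, mul_add, Finset.sum_add_distrib]
    ring
  | mem Q hQ =>
    obtain ⟨L, hL, z, hz0, hzd, hz1, rfl⟩ := hQ
    have hL' : L ∈ Wd xi k n := Wd_mono xi (by omega) le_rfl hL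
    have hzk := hz0 (k + 1) le_rfl
    refine ⟨(∑ r ∈ Finset.range c, fun t => L (X k ^ t * mon (z + Finsupp.single (k + 1) (a + r)
      + Finsupp.single (n + 1) (c - r)))) +
      fun t => (L * xi k) (X k ^ t * mon (z + Finsupp.single (k + 1) (a + c))), ?_, ?_⟩
    · refine AddSubmonoid.add_mem _ (AddSubmonoid.sum_mem _ fun r hr => ?_) ?_
      · have hr := Finset.mem_range.1 hr
        refine AddSubmonoid.subset_closure ⟨L, hL', _, fun p hp => ?_, fun p h1 h2 => ?_,
          fun _ => ?_, rfl⟩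
        · have := hz0 p (by omega)
          simp only [Finsupp.add_apply, Finsupp.single_apply]
          split_ifs <;> omega
        · simp only [Finsupp.add_apply, Finsupp.single_apply]
          by_cases hp : p = k + 1
          · subst hp
            have := hz1 (by omega)
            split_ifs <;> omega
          · have := hzd p (by omega) h2
            split_ifs <;> omega
        · simp only [Finsupp.add_apply, Finsupp.single_apply]
          split_ifs <;> omega
      · refine AddSubmonoid.subset_closure ⟨L * xi k, Submonoid.mul_mem _ hL'
          (Wd_gen xi le_rfl hk), _, fun p hp => ?_, fun p h1 h2 => ?_, fun _ => ?_, rfl⟩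
        · have := hz0 p (by omega)
          simp only [Finsupp.add_apply, Finsupp.single_apply]
          split_ifs <;> omega
        · simp only [Finsupp.add_apply, Finsupp.single_apply]
          by_cases hp : p = k + 1
          · subst hp
            have := hz1 (by omega)
            split_ifs <;> omega
          · have := hzd p (by omega) h2
            split_ifs <;> omega
        · simp only [Finsupp.add_apply, Finsupp.single_apply]
          split_ifs <;> omega
    · intro e
      simp only [Pi.add_apply, Finset.sum_apply]
      congr 1
      · rw [Finset.mul_sum]
        refine Finset.sum_congr rfl fun r _ => ?_
        rw [mon_add, mon_add, mon_single, mon_single, Wd_mul_X _ (Or.inl (by omega)) hL]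
        rw [show mon z * X (k + 1) ^ (a + r) * X (n + 1) ^ (c - r) =
          X (n + 1) ^ (c - r) * (X (k + 1) ^ (a + r) * mon z) by ring]
        rw [Wd_mul_X _ (Or.inr (by omega)) hL]
      · rw [mon_add, mon_single, mul_comm (mon z), Module.End.mul_apply, xi_string, map_sum]
        · refine Finset.sum_congr rfl fun r _ => ?_
          rw [Wd_mul_X _ (Or.inl (by omega)) hL]
        · exact s_mon _ _ (hz0 _ (by omega)) hzk

/-- The part of `lam` beyond `k`. -/
noncomputable def tail (lam : ℕ →₀ ℕ) (k : ℕ) : ℕ →₀ ℕ := lam.filter (fun p => k < p)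

lemma tail_apply (lam : ℕ →₀ ℕ) (k p : ℕ) : tail lam k p = if k < p then lam p else 0 := by
  simp [tail, Finsupp.filter_apply]

lemma mon_tail (lam : ℕ →₀ ℕ) (k : ℕ) :
    mon (tail lam k) = X (k + 1) ^ lam (k + 1) * mon (tail lam (k + 1)) := by
  rw [← mon_single, ← mon_add]
  congr 1
  ext p
  simp only [Finsupp.add_apply, Finsupp.single_apply, tail_apply]
  by_cases h : k + 1 = p
  · subst h; simp
  · split_ifs <;> omega

lemma sum_rearrange (x y : P) (S : P) (b d : ℕ) (Q : ℕ → P) (T : ℕ → P)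
    (hT : ∀ i, T i = y ^ i * S + ∑ r ∈ Finset.range (i + 1), y ^ (i - r) * Q r) :
    ∑ i ∈ Finset.range (d + 1), x ^ (b + d - i) * T i =
    ∑ e ∈ Finset.range (d + 1), y ^ (d - e) *
      (x ^ (b + e) * S + ∑ r ∈ Finset.range (e + 1), x ^ (b + e - r) * Q r) := by
  simp only [hT, mul_add, Finset.sum_add_distrib, Finset.mul_sum]
  congr 1
  · rw [← Finset.sum_range_reflect]
    refine Finset.sum_congr rfl fun i hi => ?_
    have := Finset.mem_range.1 hi
    rw [show b + d - (d + 1 - 1 - i) = b + i by omega, show d + 1 - 1 - i = d - i by omega]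
    ring
  · rw [Finset.sum_sigma', Finset.sum_sigma']
    refine Finset.sum_nbij' (fun q => ⟨d - q.1 + q.2, q.2⟩) (fun q => ⟨d - q.1 + q.2, q.2⟩)
      ?_ ?_ ?_ ?_ ?_
    · rintro ⟨i, r⟩ h
      simp only [Finset.mem_sigma, Finset.mem_range] at h ⊢
      omega
    · rintro ⟨i, r⟩ h
      simp only [Finset.mem_sigma, Finset.mem_range] at h ⊢
      omega
    · rintro ⟨i, r⟩ h
      simp only [Finset.mem_sigma, Finset.mem_range] at h ⊢
      congr 1
      omega
    · rintro ⟨i, r⟩ h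
      simp only [Finset.mem_sigma, Finset.mem_range] at h ⊢
      congr 1
      omega
    · rintro ⟨i, r⟩ h
      simp only [Finset.mem_sigma, Finset.mem_range] at h ⊢
      rw [show b + (d - i + r) - r = b + d - i by omega, show d - (d - i + r) = i - r by omega]
      ring

lemma branching (lam : ℕ →₀ ℕ) (n : ℕ) (hdom : ∀ p, p ≤ n → lam (p + 1) ≤ lam p) (d : ℕ) :
    ∀ k, k + d = n → ∃ Q ∈ Fam lam n k, ∀ e,
      cc xi k (d + 1) (X k ^ (lam (k + 1) + e) * mon (tail lam k)) =
      ∑ r ∈ Finset.range (e + 1), X (n + 1) ^ (e - r) * Q (lam (k + 1) + r) := by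
  induction d with
  | zero =>
    intro k hk
    obtain rfl : k = n := by omega
    refine ⟨fun t => (1 : Module.End ℤ P) (X k ^ t * mon (tail lam k)),
      AddSubmonoid.subset_closure ⟨1, Submonoid.one_mem _, tail lam k, fun p hp => ?_,
        fun p h1 h2 => by omega, fun h => by omega, rfl⟩, fun e => ?_⟩
    · rw [tail_apply, if_neg (by omega)]
    · have hcc : cc xi k (0 + 1) = xi k := by simp [cc]
      rw [hcc, mon_tail, xi_string]
      · rw [← Finset.sum_range_reflect]
        refine Finset.sum_congr rfl fun i hi => ?_
        have := Finset.mem_range.1 hi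
        rw [show lam (k + 1) + e - (e + 1 - 1 - i) = lam (k + 1) + i by omega,
          show e + 1 - 1 - i = e - i by omega, pow_add (X (k + 1))]
        simp only [Module.End.one_apply]
        ring
      · apply s_mon <;> rw [tail_apply, if_neg (by omega)]
  | succ d ih =>
    intro k hk
    obtain ⟨Q, hQ, hQe⟩ := ih (k + 1) (by omega)
    obtain ⟨a, ha⟩ : ∃ a, lam (k + 1 + 1) = a := ⟨_, rfl⟩
    obtain ⟨c, hc⟩ : ∃ c, lam (k + 1) = a + c :=
      ⟨lam (k + 1) - a, by have := hdom (k + 1) (by omega); omega⟩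
    obtain ⟨Q', hQ', hQe'⟩ := fam_step lam n k a c (by omega) ha hc Q hQ
    refine ⟨Q', hQ', fun e => ?_⟩
    rw [cc_succ_right, Module.End.mul_apply, mon_tail, xi_string, map_sum]
    · rw [hc]
      simp only [hQe']
      rw [← sum_rearrange (X k) (X (n + 1)) _ (a + c) e (fun r => Q (a + c + r))
        (fun i => cc xi (k + 1) (d + 1) (X (k + 1) ^ (a + c + i) * mon (tail lam (k + 1))))]
      · refine Finset.sum_congr rfl fun i _ => ?_
        exact Wd_mul_X _ (Or.inl (by omega)) (cc_mem xi (k + 1) (d + 1)) _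
      · intro i
        have := hQe (c + i)
        rw [ha] at this
        rw [add_assoc a c i, this, add_assoc c i 1, Finset.sum_range_add, Finset.mul_sum]
        congr 1
        · refine Finset.sum_congr rfl fun r hr => ?_
          have := Finset.mem_range.1 hr
          rw [show c + i - r = i + (c - r) by omega, pow_add]
          ring
        · refine Finset.sum_congr rfl fun r hr => ?_
          rw [show c + i - (c + r) = i - r by omega, add_assoc]
    · apply s_mon <;> rw [tail_apply, if_neg (by omega)]

/-- Sums of words in `ξ_0, …, ξ_{n-1}` applied to dominant monomials. -/
noncomputable def Cone (n : ℕ) : AddSubmonoid P :=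
  AddSubmonoid.closure {f | ∃ L ∈ Wd xi 0 n, ∃ z : ℕ →₀ ℕ, (∀ p, p < n → z (p + 1) ≤ z p) ∧
    f = L (mon z)}

/-- The part of `lam` before `k`. -/
noncomputable def head (lam : ℕ →₀ ℕ) (k : ℕ) : ℕ →₀ ℕ := lam.filter (fun p => p < k)

lemma head_apply (lam : ℕ →₀ ℕ) (k p : ℕ) : head lam k p = if p < k then lam p else 0 := by
  simp [head, Finsupp.filter_apply]

lemma mon_split (lam : ℕ →₀ ℕ) (k : ℕ) :
    mon lam = mon (head lam k) * (X k ^ lam k * mon (tail lam k)) := by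
  rw [← mon_single, ← mon_add, ← mon_add]
  congr 1
  ext p
  simp only [Finsupp.add_apply, Finsupp.single_apply, tail_apply, head_apply]
  rcases lt_trichotomy p k with h | h | h
  · rw [if_pos h, if_neg (by omega), if_neg (by omega)]; simp
  · subst h; simp
  · rw [if_neg (by omega), if_neg (by omega), if_pos h]; simp

lemma fam_cone (lam : ℕ →₀ ℕ) (n k : ℕ) (hk : k ≤ n)
    (hdom : ∀ p, p ≤ n → lam (p + 1) ≤ lam p) (Q : ℕ → P) (hQ : Q ∈ Fam lam n k)
    (e r : ℕ) (hr : lam (k + 1) + r ≤ lam k) :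
    mon (head lam k) * (X (n + 1) ^ e * Q (lam (k + 1) + r)) ∈ Cone n := by
  induction hQ using AddSubmonoid.closure_induction with
  | zero => simp
  | add Q₁ Q₂ _ _ h₁ h₂ =>
    rw [Pi.add_apply, mul_add, mul_add]
    exact AddSubmonoid.add_mem _ h₁ h₂
  | mem Q hQ =>
    obtain ⟨L, hL, z, hz0, hzd, hz1, rfl⟩ := hQ
    refine AddSubmonoid.subset_closure ⟨L, Wd_mono xi (by omega) le_rfl hL,
      head lam k + (Finsupp.single (n + 1) e + (Finsupp.single k (lam (k + 1) + r) + z)), ?_, ?_⟩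
    · intro p hp
      simp only [Finsupp.add_apply, Finsupp.single_apply, head_apply]
      have h1 := hdom p (by omega)
      rcases lt_trichotomy p k with h | h | h
      · have h2 := hz0 p (by omega)
        have h3 := hz0 (p + 1) (by omega)
        by_cases h4 : p + 1 = k
        · subst h4
          split_ifs <;> omega
        · split_ifs <;> omega
      · subst h
        have h2 := hz0 p le_rfl
        have h3 := hz1 hp
        split_ifs <;> omega
      · have h2 := hzd p h hp
        split_ifs <;> omega
    · rw [mon_add, mon_add, mon_add, mon_single, mon_single,
        Wd_mul (mon (head lam k)) _ hL, Wd_mul_X _ (Or.inr (by omega)) hL]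
      intro i h1 h2
      apply s_mon <;> rw [head_apply, if_neg (by omega)]

lemma cc_cone (lam : ℕ →₀ ℕ) (n k d : ℕ) (hk : k + d = n)
    (hdom : ∀ p, p ≤ n → lam (p + 1) ≤ lam p) : cc xi k (d + 1) (mon lam) ∈ Cone n := by
  obtain ⟨Q, hQ, hQe⟩ := branching lam n hdom d k hk
  have h := hQe (lam k - lam (k + 1))
  have hle := hdom k (by omega)
  rw [show lam (k + 1) + (lam k - lam (k + 1)) = lam k by omega] at h
  rw [mon_split lam k, Wd_mul (mon (head lam k)) _ (cc_mem xi k (d + 1)), h, Finset.mul_sum]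
  · refine AddSubmonoid.sum_mem _ fun r hr => ?_
    have := Finset.mem_range.1 hr
    exact fam_cone lam n k (by omega) hdom Q hQ _ _ (by omega)
  · intro i h1 h2
    apply s_mon <;> rw [head_apply, if_neg (by omega)]

lemma word_nonneg (n : ℕ) : ∀ (lam : ℕ →₀ ℕ), (∀ p, p < n → lam (p + 1) ≤ lam p) →
    ∀ u ∈ Wd xi 0 n, ∀ m, 0 ≤ coeff m (u (mon lam)) := by
  induction n with
  | zero =>
    intro lam _ u hu m
    have hbot : Wd xi 0 0 ≤ ⊥ := by
      rw [Wd, Submonoid.closure_le]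
      rintro x ⟨i, _, h, _⟩
      omega
    obtain rfl : u = 1 := hbot hu
    rw [Module.End.one_apply, mon, coeff_monomial]
    split_ifs <;> simp
  | succ n ih =>
    intro lam hdom w hw m
    obtain ⟨u, hu, k, l, hkl, rfl⟩ := nf n w hw
    rcases l with _ | d
    · rw [cc, mul_one]
      exact ih lam (fun p hp => hdom p (by omega)) u hu m
    · rw [Module.End.mul_apply]
      have hcone := cc_cone lam n k d (by omega) (fun p hp => hdom p (by omega))
      generalize cc xi k (d + 1) (mon lam) = F at hcone
      induction hcone using AddSubmonoid.closure_induction with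
      | zero => simp
      | add f g _ _ hf hg =>
        rw [map_add, coeff_add]
        exact add_nonneg hf hg
      | mem f hf =>
        obtain ⟨L, hL, z, hz, rfl⟩ := hf
        rw [← Module.End.mul_apply]
        exact ih z hz _ (Submonoid.mul_mem _ hu hL) m

lemma key_word (γ : ℕ →₀ ℕ) (f : P) (hf : IsKey γ f) :
    ∃ n, ∃ u ∈ Wd xi 0 n, ∃ lam : ℕ →₀ ℕ, (∀ p, lam (p + 1) ≤ lam p) ∧ f = u (mon lam) := by
  induction hf with
  | base γ hγ =>
    exact ⟨0, 1, Submonoid.one_mem _, γ, fun p => hγ _ _ (Nat.le_succ p), rfl⟩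
  | step γ i h f g hf hg ih =>
    obtain ⟨n, u, hu, lam, hl, rfl⟩ := ih
    refine ⟨max n (i + 1), xi i * u, Submonoid.mul_mem _ (Wd_gen xi (by omega) (by omega))
      (Wd_mono xi le_rfl (by omega) hu), lam, hl, ?_⟩
    exact xi_unique i _ g hg

end KeyPos

/-- For any composition `γ`, the key polynomial `K_γ` has nonnegative
integer coefficients. -/
theorem key_poly_coeffs_nonneg (γ : ℕ →₀ ℕ) (f : MvPolynomial ℕ ℤ)
    (hf : IsKey γ f) :
    ∀ m : ℕ →₀ ℕ, 0 ≤ coeff m f := by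
  obtain ⟨n, u, hu, lam, hl, rfl⟩ := KeyPos.key_word γ f hf
  exact KeyPos.word_nonneg n lam (fun p _ => hl p) u hu
end
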